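/- arXiv:2010.14719 — 4 statements merged into one kernel-verified Lean document; each statement's English description precedes it below -/
import Mathlib

section
/- Generic points have full measure for ergodic measures along tempered Følner sequences: Let (X,G) be a G-action topological dynamical system with G a countable infinite discrete amenable group, let μ be an ergodic G-invariant Borel probability measure on X, and let {F_n} be a tempered Følner sequence in G. Then μ(G_μ) = 1. -/
open Filter Set MeasureTheory ENNReal Topology
open scoped Pointwise symmDiff NNReal

namespace AmenablePacking

variable {G X Y : Type*}

/-- The open dynamical (Bowen) ball of center `x` and radius `ε` over the finite set `F`. -/
def dynBall [PseudoMetricSpace X] (act : G → X → X) (F : Finset G) (x : X) (ε : ℝ) : Set X :=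
  {y | ∀ g ∈ F, dist (act g x) (act g y) < ε}

/-- The closed dynamical (Bowen) ball of center `x` and radius `ε` over the finite set `F`. -/
def dynClosedBall [PseudoMetricSpace X] (act : G → X → X) (F : Finset G) (x : X) (ε : ℝ) :
    Set X :=
  {y | ∀ g ∈ F, dist (act g x) (act g y) ≤ ε}

/-- The packing pre-measure `P(Z, N, ε, s, {F_n})`: the supremum of `∑ᵢ exp (- s |F_{n_i}|)` over
all finite or countable pairwise disjoint families of closed Bowen balls with centers in `Z`
and indices `n_i ≥ N`. -/
noncomputable def packP [PseudoMetricSpace X] (act : G → X → X) (Fs : ℕ → Finset G) (Z : Set X)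
    (N : ℕ) (ε s : ℝ) : ℝ≥0∞ :=
  ⨆ (t : Set ℕ) (c : ℕ → X × ℕ) (_ : ∀ i ∈ t, (c i).1 ∈ Z ∧ N ≤ (c i).2)
    (_ : ∀ i ∈ t, ∀ j ∈ t, i ≠ j →
      Disjoint (dynClosedBall act (Fs (c i).2) (c i).1 ε)
        (dynClosedBall act (Fs (c j).2) (c j).1 ε)),
    ∑' i : t, ENNReal.ofReal (Real.exp (-s * ((Fs (c (i : ℕ)).2).card : ℝ)))

/-- `P(Z, ε, s, {F_n}) = lim_{N → ∞} P(Z, N, ε, s, {F_n})`; the quantity is non-increasing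
in `N`, so the limit equals the infimum. -/
noncomputable def packPLim [PseudoMetricSpace X] (act : G → X → X) (Fs : ℕ → Finset G)
    (Z : Set X) (ε s : ℝ) : ℝ≥0∞ :=
  ⨅ N : ℕ, packP act Fs Z N ε s

/-- `𝒫(Z, ε, s, {F_n})`: the countably subadditive envelope of `P(·, ε, s, {F_n})`. -/
noncomputable def packOuter [PseudoMetricSpace X] (act : G → X → X) (Fs : ℕ → Finset G)
    (Z : Set X) (ε s : ℝ) : ℝ≥0∞ :=
  ⨅ (Zs : ℕ → Set X) (_ : Z ⊆ ⋃ i, Zs i), ∑' i, packPLim act Fs (Zs i) ε s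

/-- `h^P_top(Z, ε, {F_n})`: the critical value of `s ≥ 0` at which `𝒫(Z, ε, s, {F_n})` jumps
from `+∞` to `0`. -/
noncomputable def packEntEps [PseudoMetricSpace X] (act : G → X → X) (Fs : ℕ → Finset G)
    (Z : Set X) (ε : ℝ) : ℝ≥0∞ :=
  ⨅ (s : ℝ≥0) (_ : packOuter act Fs Z ε (s : ℝ) = 0), (s : ℝ≥0∞)

/-- The amenable packing topological entropy
`h^P_top(Z, {F_n}) = lim_{ε → 0} h^P_top(Z, ε, {F_n})`. -/
noncomputable def packEnt [PseudoMetricSpace X] (act : G → X → X) (Fs : ℕ → Finset G)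
    (Z : Set X) : ℝ≥0∞ :=
  ⨆ (ε : ℝ) (_ : 0 < ε), packEntEps act Fs Z ε

/-- The Bowen pre-measure `ℳ(Z, N, ε, s, {F_n})`: the infimum of `∑ᵢ exp (- s |F_{n_i}|)` over
all finite or countable families of open Bowen balls with indices `n_i ≥ N` covering `Z`. -/
noncomputable def bowenM [PseudoMetricSpace X] (act : G → X → X) (Fs : ℕ → Finset G) (Z : Set X)
    (N : ℕ) (ε s : ℝ) : ℝ≥0∞ :=
  ⨅ (t : Set ℕ) (c : ℕ → X × ℕ) (_ : ∀ i ∈ t, N ≤ (c i).2)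
    (_ : Z ⊆ ⋃ i ∈ t, dynBall act (Fs (c i).2) (c i).1 ε),
    ∑' i : t, ENNReal.ofReal (Real.exp (-s * ((Fs (c (i : ℕ)).2).card : ℝ)))

/-- `ℳ(Z, s, {F_n}) = lim_{ε → 0} lim_{N → ∞} ℳ(Z, N, ε, s, {F_n})`. -/
noncomputable def bowenMLim [PseudoMetricSpace X] (act : G → X → X) (Fs : ℕ → Finset G)
    (Z : Set X) (s : ℝ) : ℝ≥0∞ :=
  ⨆ (ε : ℝ) (_ : 0 < ε), ⨆ N : ℕ, bowenM act Fs Z N ε s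

/-- The amenable Bowen topological entropy `h^B_top(Z, {F_n})`: the critical value of `s ≥ 0`
at which `ℳ(Z, s, {F_n})` jumps from `+∞` to `0`. -/
noncomputable def bowenEnt [PseudoMetricSpace X] (act : G → X → X) (Fs : ℕ → Finset G)
    (Z : Set X) : ℝ≥0∞ :=
  ⨅ (s : ℝ≥0) (_ : bowenMLim act Fs Z (s : ℝ) = 0), (s : ℝ≥0∞)

/-- `E` is an `(F, ε)`-separated set: distinct points are at `d_F`-distance `> ε`. -/
def IsDynSeparated [PseudoMetricSpace X] (act : G → X → X) (F : Finset G) (ε : ℝ)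
    (E : Set X) : Prop :=
  ∀ x ∈ E, ∀ y ∈ E, x ≠ y → ∃ g ∈ F, ε < dist (act g x) (act g y)

/-- `s_F(Z, ε)`: the maximal cardinality of an `(F, ε)`-separated subset of `Z`. -/
noncomputable def sepNum [PseudoMetricSpace X] (act : G → X → X) (F : Finset G) (Z : Set X)
    (ε : ℝ) : ℕ :=
  sSup {k : ℕ | ∃ E : Finset X, ↑E ⊆ Z ∧ IsDynSeparated act F ε ↑E ∧ E.card = k}

/-- The upper capacity entropy of `Z` at scale `ε`:
`limsup_n (1/|F_n|) log s_{F_n}(Z, ε)`. -/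
noncomputable def ucEntEps [PseudoMetricSpace X] (act : G → X → X) (Fs : ℕ → Finset G)
    (Z : Set X) (ε : ℝ) : ℝ≥0∞ :=
  limsup (fun n => ENNReal.ofReal (Real.log ((sepNum act (Fs n) Z ε : ℝ)) / ((Fs n).card : ℝ)))
    atTop

/-- The upper capacity topological entropy `h^{UC}_top(Z, {F_n})`. -/
noncomputable def ucEnt [PseudoMetricSpace X] (act : G → X → X) (Fs : ℕ → Finset G)
    (Z : Set X) : ℝ≥0∞ :=
  ⨆ (ε : ℝ) (_ : 0 < ε), ucEntEps act Fs Z ε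

/-- The upper local entropy `h̄^loc_μ(Z, {F_n}) =
`∫_Z lim_{ε→0} limsup_n -(1/|F_n|) log μ(B_{F_n}(x, ε)) dμ`. -/
noncomputable def upperLocalEnt [PseudoMetricSpace X] [MeasurableSpace X] (act : G → X → X)
    (Fs : ℕ → Finset G) (μ : Measure X) (Z : Set X) : ℝ≥0∞ :=
  ∫⁻ x in Z, ⨆ (ε : ℝ) (_ : 0 < ε),
    limsup (fun n =>
      ENNReal.ofReal (-Real.log ((μ (dynBall act (Fs n) x ε)).toReal) / ((Fs n).card : ℝ)))
      atTop ∂μ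

/-- A Følner sequence: a sequence of nonempty finite subsets of `G` which is asymptotically
invariant, i.e. `|g F_n ∆ F_n| / |F_n| → 0` for every `g ∈ G`. -/
def Folner [Group G] [DecidableEq G] (Fs : ℕ → Finset G) : Prop :=
  (∀ n, (Fs n).Nonempty) ∧
    ∀ g : G,
      Tendsto (fun n => ((((Fs n).image fun h => g * h) ∆ Fs n).card : ℝ) / ((Fs n).card : ℝ))
        atTop (nhds 0)

/-- A tempered sequence: `|⋃_{k < n} F_k⁻¹ F_n| ≤ C |F_n|` for a constant `C > 0`. -/
def Tempered [Group G] [DecidableEq G] (Fs : ℕ → Finset G) : Prop :=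
  ∃ C : ℝ, 0 < C ∧
    ∀ n : ℕ, ((((Finset.range n).biUnion fun k => (Fs k)⁻¹ * Fs n).card : ℝ))
      ≤ C * ((Fs n).card : ℝ)

/-- The growth condition `lim_n |F_n| / log n = +∞`. -/
def GrowthCond (Fs : ℕ → Finset G) [Group G] : Prop :=
  Tendsto (fun n => ((Fs n).card : ℝ) / Real.log (n : ℝ)) atTop atTop

/-- The static (Shannon) entropy of the finite measurable partition of `X` induced by a map
into a finite set. -/
noncomputable def partEnt [MeasurableSpace X] (μ : Measure X) {ι : Type*} [Fintype ι]
    (P : X → ι) : ℝ :=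
  ∑ i : ι, Real.negMulLog ((μ (P ⁻¹' {i})).toReal)

/-- The measure-theoretic (Kolmogorov–Sinai) entropy `h_μ(X, G)` of the action w.r.t. the
invariant measure `μ`, computed along the Følner sequence `{F_n}`: the supremum over finite
measurable partitions `P` of `lim_n (1/|F_n|) H_μ(⋁_{g ∈ F_n} (act g)⁻¹ P)`. -/
noncomputable def measEnt [MeasurableSpace X] [DecidableEq G] (act : G → X → X)
    (Fs : ℕ → Finset G) (μ : Measure X) : ℝ≥0∞ :=
  ⨆ (k : ℕ) (P : X → Fin k) (_ : Measurable P),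
    limsup (fun n => ENNReal.ofReal
      ((partEnt μ fun x (g : (Fs n : Finset G)) => P (act (g : G) x)) / ((Fs n).card : ℝ)))
      atTop

/-- The set of generic points of `μ` w.r.t. `{F_n}`. -/
def genericPoints [TopologicalSpace X] [MeasurableSpace X] (act : G → X → X)
    (Fs : ℕ → Finset G) (μ : Measure X) : Set X :=
  {x | ∀ f : C(X, ℝ),
    Tendsto (fun n => (∑ g ∈ Fs n, f (act g x)) / ((Fs n).card : ℝ)) atTop
      (nhds (∫ y, f y ∂μ))}

/-- `μ` is invariant under the action. -/
def InvariantMeasure [MeasurableSpace X] (act : G → X → X) (μ : Measure X) : Prop :=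
  ∀ (g : G) (s : Set X), MeasurableSet s → μ (act g ⁻¹' s) = μ s

/-- The action is ergodic w.r.t. `μ`: every invariant measurable set is null or conull. -/
def ErgodicAction [MeasurableSpace X] (act : G → X → X) (μ : Measure X) : Prop :=
  ∀ s : Set X, MeasurableSet s → (∀ g : G, act g ⁻¹' s = s) → μ s = 0 ∨ μ s = 1

/-- Fractional covering weights: the levels `n < N` are processed downwards, and a point of `E n`
keeps the part of its unit mass that is not used up by the weights of higher levels whose
translates meet its own. -/
noncomputable def coverWeight [Group G] [DecidableEq G] (act : G → X → X) (Fs : ℕ → Finset G)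
    (E : ℕ → Set X) (N n : ℕ) : X → ℝ≥0∞ :=
  (E n).indicator fun x => 1 - ∑ m : {m // m ∈ Finset.Ioo n N}, ∑ h ∈ (Fs m)⁻¹ * Fs n,
    coverWeight act Fs E N m (act h x) / ((Fs m).card : ℝ≥0∞)
termination_by N - n
decreasing_by
  have := Finset.mem_Ioo.1 m.2
  omega

section CoverWeight

variable [Group G] [DecidableEq G] {act : G → X → X} {Fs : ℕ → Finset G} {E : ℕ → Set X}

theorem coverWeight_eq (N n : ℕ) :
    coverWeight act Fs E N n = (E n).indicator fun x => 1 - ∑ m ∈ Finset.Ioo n N,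
      ∑ h ∈ (Fs m)⁻¹ * Fs n, coverWeight act Fs E N m (act h x) / ((Fs m).card : ℝ≥0∞) := by
  rw [coverWeight]
  congr 1
  funext x
  rw [← Finset.sum_coe_sort (Finset.Ioo n N)]

theorem measurable_coverWeight [MeasurableSpace X] (hact : ∀ g, Measurable (act g))
    (hE : ∀ n, MeasurableSet (E n)) (N n : ℕ) : Measurable (coverWeight act Fs E N n) := by
  induction hk : N - n using Nat.strong_induction_on generalizing n with
  | _ k ih =>
    rw [coverWeight_eq]
    refine Measurable.indicator ?_ (hE n)
    refine measurable_const.sub (Finset.measurable_fun_sum _ fun m hm =>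
      Finset.measurable_fun_sum _ fun h _ => Measurable.div_const ?_ _)
    have := Finset.mem_Ioo.1 hm
    exact (ih (N - m) (by omega) m rfl).comp (hact h)

/-- The translates of the weights overlap with total mass at most one. -/
theorem sum_coverWeight_le_one
    (hact_mul : ∀ g h x, act (g * h) x = act g (act h x)) (hne : ∀ n, (Fs n).Nonempty)
    (N n : ℕ) (y : X) :
    ∑ m ∈ Finset.Ico n N, ∑ h ∈ Fs m,
      coverWeight act Fs E N m (act h⁻¹ y) / ((Fs m).card : ℝ≥0∞) ≤ 1 := by
  induction hk : N - n generalizing n with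
  | zero => rw [Finset.Ico_eq_empty (by omega)]; simp
  | succ k ih =>
    have hn : n < N := by omega
    rw [← Finset.insert_Ico_add_one_left_eq_Ico hn, Finset.sum_insert (by simp)]
    set O := ∑ m ∈ Finset.Ico (n + 1) N, ∑ h ∈ Fs m,
      coverWeight act Fs E N m (act h⁻¹ y) / ((Fs m).card : ℝ≥0∞) with hO
    have hO1 : O ≤ 1 := ih (n + 1) (by omega)
    have key : ∀ h ∈ Fs n, coverWeight act Fs E N n (act h⁻¹ y) ≤ 1 - O := by
      intro h hh
      rw [coverWeight_eq]
      refine (Set.indicator_le_self' (fun _ _ => zero_le) _).trans (tsub_le_tsub_left ?_ _)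
      rw [hO]
      refine Finset.sum_le_sum fun m _ => ?_
      have hinj : Set.InjOn (fun h' : G => h'⁻¹ * h) (Fs m) := fun a _ b _ hab => by
        simpa using hab
      calc _ = ∑ k ∈ (Fs m).image fun h' => h'⁻¹ * h,
            coverWeight act Fs E N m (act k (act h⁻¹ y)) / ((Fs m).card : ℝ≥0∞) := by
            rw [Finset.sum_image hinj]
            refine Finset.sum_congr rfl fun h' _ => ?_
            rw [← hact_mul, mul_assoc, mul_inv_cancel, mul_one]
        _ ≤ _ := by
            refine Finset.sum_le_sum_of_subset fun k hk => ?_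
            obtain ⟨h', hh', rfl⟩ := Finset.mem_image.1 hk
            exact Finset.mul_mem_mul (Finset.inv_mem_inv hh') hh
    have hc : ((Fs n).card : ℝ≥0∞) ≠ 0 := by
      simpa [Finset.card_eq_zero] using (hne n).ne_empty
    calc _ ≤ ∑ h ∈ Fs n, (1 - O) / ((Fs n).card : ℝ≥0∞) + O := by
          gcongr with h hh
          exact key h hh
      _ = (1 - O) + O := by
          rw [Finset.sum_const, nsmul_eq_mul, ENNReal.mul_div_cancel hc (by simp)]
      _ = 1 := tsub_add_cancel_of_le hO1

/-- The weights carry a fixed proportion of the total mass of the disjoint sets `E n`. -/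
theorem sum_measure_le_lintegral_coverWeight [MeasurableSpace X] {μ : Measure X}
    (hact : ∀ g, MeasurePreserving (act g) μ μ) (hE : ∀ n, MeasurableSet (E n))
    (hdisj : Pairwise (Function.onFun Disjoint E)) (hne : ∀ n, (Fs n).Nonempty) {C : ℝ≥0∞}
    (hC : ∀ n, (((Finset.range n).biUnion fun k => (Fs k)⁻¹ * Fs n).card : ℝ≥0∞)
      ≤ C * ((Fs n).card : ℝ≥0∞)) (N : ℕ) :
    ∑ n ∈ Finset.range N, μ (E n) ≤
      (1 + C) * ∑ n ∈ Finset.range N, ∫⁻ x, coverWeight act Fs E N n x ∂μ := by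
  set u := coverWeight act Fs E N with hu
  have humeas : ∀ n, Measurable (u n) :=
    measurable_coverWeight (fun g => (hact g).measurable) hE N
  set K : ℕ → Finset G := fun m => (Finset.range m).biUnion fun n => (Fs m)⁻¹ * Fs n with hK
  have hKcard : ∀ m, ((K m).card : ℝ≥0∞) ≤ C * ((Fs m).card : ℝ≥0∞) := by
    intro m
    refine le_trans (le_of_eq ?_) (hC m)
    rw [← Finset.card_inv (K m)]
    congr 2
    rw [hK, ← Finset.image_inv_eq_inv, Finset.biUnion_image]
    simp only [Finset.image_inv_eq_inv, mul_inv_rev, inv_inv]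
  have hmeas : ∀ m h, Measurable fun x => u m (act h x) / ((Fs m).card : ℝ≥0∞) :=
    fun m h => ((humeas m).comp (hact h).measurable).div_const _
  have hpt : ∀ x, ∑ n ∈ Finset.range N, (E n).indicator 1 x ≤
      ∑ n ∈ Finset.range N, u n x + ∑ m ∈ Finset.range N, ∑ h ∈ K m,
        u m (act h x) / ((Fs m).card : ℝ≥0∞) := by
    intro x
    by_cases hx : ∃ k ∈ Finset.range N, x ∈ E k
    · obtain ⟨k, hk, hxk⟩ := hx
      rw [Finset.sum_eq_single_of_mem k hk fun j _ hj => Set.indicator_of_notMem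
        (fun hxj => Set.disjoint_left.1 (hdisj hj) hxj hxk) _, Set.indicator_of_mem hxk]
      have h1 : (1 : ℝ≥0∞) ≤ u k x + ∑ m ∈ Finset.Ioo k N, ∑ h ∈ (Fs m)⁻¹ * Fs k,
          u m (act h x) / ((Fs m).card : ℝ≥0∞) := by
        rw [hu, coverWeight_eq N k, Set.indicator_of_mem hxk]
        exact le_tsub_add
      refine h1.trans (add_le_add (Finset.single_le_sum (f := fun n => u n x)
        (fun _ _ => zero_le) hk) ?_)
      refine (Finset.sum_le_sum fun m hm => ?_).trans (Finset.sum_le_sum_of_subset fun m hm =>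
        Finset.mem_range.2 (Finset.mem_Ioo.1 hm).2)
      exact Finset.sum_le_sum_of_subset (Finset.subset_biUnion_of_mem (fun n => (Fs m)⁻¹ * Fs n)
        (Finset.mem_range.2 (Finset.mem_Ioo.1 hm).1))
    · push Not at hx
      rw [Finset.sum_eq_zero fun j hj => Set.indicator_of_notMem (hx j hj) _]
      exact zero_le
  have hint := lintegral_mono hpt (μ := μ)
  rw [lintegral_finsetSum _ fun n _ => measurable_one.indicator (hE n),
    lintegral_add_left (Finset.measurable_fun_sum _ fun n _ => humeas n),
    lintegral_finsetSum _ fun n _ => humeas n,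
    lintegral_finsetSum _ fun m _ => Finset.measurable_fun_sum _ fun h _ => hmeas m h] at hint
  simp only [lintegral_indicator_one (hE _)] at hint
  refine hint.trans ?_
  rw [add_mul, one_mul, Finset.mul_sum]
  gcongr with m hm
  rw [lintegral_finsetSum _ fun h _ => hmeas m h]
  have hc : ((Fs m).card : ℝ≥0∞) ≠ 0 := by
    simpa [Finset.card_eq_zero] using (hne m).ne_empty
  have : ∀ h ∈ K m, ∫⁻ x, u m (act h x) / ((Fs m).card : ℝ≥0∞) ∂μ =
      (∫⁻ x, u m x ∂μ) / ((Fs m).card : ℝ≥0∞) := by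
    intro h _
    rw [(hact h).lintegral_comp ((humeas m).div_const _)]
    simp only [div_eq_mul_inv]
    rw [lintegral_mul_const _ (humeas m)]
  rw [Finset.sum_congr rfl this, Finset.sum_const, nsmul_eq_mul, ← mul_div_assoc]
  refine ENNReal.div_le_of_le_mul ?_
  calc _ ≤ C * ((Fs m).card : ℝ≥0∞) * ∫⁻ x, u m x ∂μ := by gcongr; exact hKcard m
    _ = _ := by ring

/-- The weak type `(1, 1)` maximal inequality along a tempered sequence. -/
theorem mul_measure_exists_lt_sum_le [MeasurableSpace X] {μ : Measure X}
    (hact_one : ∀ x, act 1 x = x) (hact_mul : ∀ g h x, act (g * h) x = act g (act h x))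
    (hact : ∀ g, MeasurePreserving (act g) μ μ) (hne : ∀ n, (Fs n).Nonempty) {C : ℝ≥0∞}
    (hC : ∀ n, (((Finset.range n).biUnion fun k => (Fs k)⁻¹ * Fs n).card : ℝ≥0∞)
      ≤ C * ((Fs n).card : ℝ≥0∞)) {f : X → ℝ≥0∞} (hf : Measurable f) (t : ℝ≥0∞) :
    t * μ {x | ∃ n, t * ((Fs n).card : ℝ≥0∞) < ∑ h ∈ Fs n, f (act h x)} ≤
      (1 + C) * ∫⁻ x, f x ∂μ := by
  set A : ℕ → Set X := fun n => {x | t * ((Fs n).card : ℝ≥0∞) < ∑ h ∈ Fs n, f (act h x)} with hA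
  have hAm : ∀ n, MeasurableSet (A n) := fun n => measurableSet_lt measurable_const
    (Finset.measurable_fun_sum _ fun h _ => hf.comp (hact h).measurable)
  have hEm : ∀ n, MeasurableSet (disjointed A n) := fun n => MeasurableSet.disjointed hAm n
  have hUnion : {x | ∃ n, t * ((Fs n).card : ℝ≥0∞) < ∑ h ∈ Fs n, f (act h x)} =
      ⋃ n, disjointed A n := by
    rw [iUnion_disjointed]
    ext x
    simp [hA]
  rw [hUnion, measure_iUnion (disjoint_disjointed A) hEm, ← ENNReal.tsum_mul_left]
  refine ENNReal.tsum_le_of_sum_range_le fun N => ?_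
  rw [← Finset.mul_sum]
  set u := coverWeight act Fs (disjointed A) N with hu
  have humeas : ∀ n, Measurable (u n) :=
    measurable_coverWeight (fun g => (hact g).measurable) hEm N
  have hpt : ∀ n x, t * u n x ≤ ∑ h ∈ Fs n, f (act h x) * (u n x / ((Fs n).card : ℝ≥0∞)) := by
    intro n x
    by_cases hx : x ∈ disjointed A n
    · have hxA : t * ((Fs n).card : ℝ≥0∞) < ∑ h ∈ Fs n, f (act h x) := disjointed_subset A n hx
      have hc : ((Fs n).card : ℝ≥0∞) ≠ 0 := by
        simpa [Finset.card_eq_zero] using (hne n).ne_empty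
      rw [← Finset.sum_mul]
      calc t * u n x = t * ((Fs n).card : ℝ≥0∞) * (u n x / ((Fs n).card : ℝ≥0∞)) := by
            rw [mul_assoc, ENNReal.mul_div_cancel hc (by simp)]
        _ ≤ _ := by gcongr
    · have : u n x = 0 := by rw [hu, coverWeight_eq, Set.indicator_of_notMem hx]
      simp [this]
  have hm : ∀ n h, Measurable fun x => f x * (u n (act h⁻¹ x) / ((Fs n).card : ℝ≥0∞)) :=
    fun n h => hf.mul (((humeas n).comp (hact h⁻¹).measurable).div_const _)
  have hm' : ∀ n h, Measurable fun x => f (act h x) * (u n x / ((Fs n).card : ℝ≥0∞)) :=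
    fun n h => (hf.comp (hact h).measurable).mul ((humeas n).div_const _)
  have hshift : ∀ n h, ∫⁻ x, f (act h x) * (u n x / ((Fs n).card : ℝ≥0∞)) ∂μ =
      ∫⁻ y, f y * (u n (act h⁻¹ y) / ((Fs n).card : ℝ≥0∞)) ∂μ := by
    intro n h
    rw [← (hact h).lintegral_comp (hm n h)]
    refine lintegral_congr fun x => ?_
    rw [← hact_mul, inv_mul_cancel, hact_one]
  calc t * ∑ n ∈ Finset.range N, μ (disjointed A n)
      ≤ t * ((1 + C) * ∑ n ∈ Finset.range N, ∫⁻ x, u n x ∂μ) := by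
        gcongr
        exact sum_measure_le_lintegral_coverWeight hact hEm (disjoint_disjointed A) hne hC N
    _ = (1 + C) * ∑ n ∈ Finset.range N, ∫⁻ x, t * u n x ∂μ := by
        simp only [lintegral_const_mul _ (humeas _), ← Finset.mul_sum]
        ring
    _ ≤ (1 + C) * ∑ n ∈ Finset.range N,
          ∫⁻ x, ∑ h ∈ Fs n, f (act h x) * (u n x / ((Fs n).card : ℝ≥0∞)) ∂μ := by
        gcongr with n hn x
        exact hpt n x
    _ = (1 + C) * ∫⁻ y, f y * ∑ n ∈ Finset.range N, ∑ h ∈ Fs n,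
          u n (act h⁻¹ y) / ((Fs n).card : ℝ≥0∞) ∂μ := by
        congr 1
        simp only [Finset.mul_sum]
        rw [lintegral_finsetSum _ fun n _ => Finset.measurable_fun_sum _ fun h _ => hm n h]
        refine Finset.sum_congr rfl fun n _ => ?_
        rw [lintegral_finsetSum _ fun h _ => hm' n h, lintegral_finsetSum _ fun h _ => hm n h]
        exact Finset.sum_congr rfl fun h _ => hshift n h
    _ ≤ (1 + C) * ∫⁻ y, f y ∂μ := by
        gcongr with y
        refine mul_le_of_le_one_right' ?_
        simpa using sum_coverWeight_le_one (E := disjointed A) hact_mul hne N 0 y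

end CoverWeight

theorem tendsto_average_coboundary [Group G] [DecidableEq G] {act : G → X → X}
    (hact_mul : ∀ g h x, act (g * h) x = act g (act h x)) {Fs : ℕ → Finset G} (hFol : Folner Fs)
    {h : X → ℝ} {M : ℝ} (hM : ∀ x, |h x| ≤ M) (a : G) (x : X) :
    Tendsto (fun n => (∑ g ∈ Fs n, (h (act a (act g x)) - h (act g x))) / ((Fs n).card : ℝ))
      atTop (𝓝 0) := by
  have hlim := (hFol.2 a).const_mul M
  rw [mul_zero] at hlim
  refine squeeze_zero_norm (fun n => ?_) hlim
  rw [norm_div, RCLike.norm_natCast, ← mul_div_assoc]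
  gcongr
  have himage : ∑ g ∈ Fs n, h (act a (act g x)) =
      ∑ g ∈ (Fs n).image fun k => a * k, h (act g x) := by
    rw [Finset.sum_image fun _ _ _ _ hab => mul_left_cancel hab]
    simp only [hact_mul]
  set s := (Fs n).image fun k => a * k
  rw [Finset.sum_sub_distrib, himage, ← Finset.sum_sdiff_sub_sum_sdiff]
  have hdisj : Disjoint (s \ Fs n) (Fs n \ s) := disjoint_sdiff_sdiff
  calc _ ≤ ∑ g ∈ s \ Fs n, ‖h (act g x)‖ + ∑ g ∈ Fs n \ s, ‖h (act g x)‖ :=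
        (norm_sub_le _ _).trans (add_le_add (norm_sum_le _ _) (norm_sum_le _ _))
    _ = ∑ g ∈ s ∆ Fs n, ‖h (act g x)‖ := by
        rw [← Finset.sum_union hdisj]
        rfl
    _ ≤ _ := by
        rw [mul_comm, ← nsmul_eq_mul]
        exact Finset.sum_le_card_nsmul _ _ _ fun g _ => hM _

theorem ae_eq_zero_of_ae_invariant [Group G] [Countable G] [MeasurableSpace X] {act : G → X → X}
    (hact_mul : ∀ g h x, act (g * h) x = act g (act h x))
    {μ : Measure X} [IsProbabilityMeasure μ] (hact : ∀ g, Measurable (act g))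
    (herg : ErgodicAction act μ) {k : X → ℝ} (hk : Measurable k) (hint : Integrable k μ)
    (hk_inv : ∀ g, ∀ᵐ x ∂μ, k (act g x) = k x) (hk_zero : ∫ x, k x ∂μ = 0) : k =ᵐ[μ] 0 := by
  set S : Set X := {x | ∀ g, 0 < k (act g x)} with hS
  have hSm : MeasurableSet S := by
    rw [hS, ofPred_forall]
    exact MeasurableSet.iInter fun g => measurableSet_lt measurable_const (hk.comp (hact g))
  have hSinv : ∀ g, act g ⁻¹' S = S := by
    intro g
    ext x
    simp only [hS, mem_preimage, mem_ofPred_eq, ← hact_mul]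
    exact ⟨fun h a => by simpa using h (a * g⁻¹), fun h a => h _⟩
  have hSk : ∀ᵐ x ∂μ, x ∈ S ↔ 0 < k x := by
    filter_upwards [ae_all_iff.2 hk_inv] with x hx
    simp [hS, hx]
  rcases herg S hSm hSinv with h0 | h1
  · have hneg : 0 ≤ᵐ[μ] -k := by
      filter_upwards [hSk, measure_eq_zero_iff_ae_notMem.1 h0] with x hx hxS
      simpa using not_lt.1 fun h => hxS (hx.2 h)
    have := (integral_eq_zero_iff_of_nonneg_ae hneg hint.neg).1 (by simp [integral_neg, hk_zero])
    filter_upwards [this] with x hx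
    simpa using hx
  · have hpos : 0 ≤ᵐ[μ] k := by
      filter_upwards [hSk, (mem_ae_iff_prob_eq_one hSm).2 h1] with x hx hxS
      exact (hx.1 hxS).le
    exact (integral_eq_zero_iff_of_nonneg_ae hpos hint).1 hk_zero

section Continuous

variable [TopologicalSpace X] [CompactSpace X] [MeasurableSpace X] [BorelSpace X]

/-- The continuous functions whose averages converge everywhere to their integral. -/
def convergenceSubmodule (act : G → X → X) (Fs : ℕ → Finset G) (μ : Measure X)
    [IsFiniteMeasure μ] : Submodule ℝ C(X, ℝ) where
  carrier := {h | ∀ x, Tendsto (fun n => (∑ g ∈ Fs n, h (act g x)) / ((Fs n).card : ℝ)) atTop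
    (𝓝 (∫ y, h y ∂μ))}
  zero_mem' x := by simp
  add_mem' {h₁ h₂} hh₁ hh₂ x := by
    have hi : ∀ h : C(X, ℝ), Integrable h μ := fun h =>
      h.continuous.integrable_of_hasCompactSupport (HasCompactSupport.of_compactSpace h)
    simp only [ContinuousMap.add_apply, Finset.sum_add_distrib, add_div]
    rw [integral_add (hi h₁) (hi h₂)]
    exact (hh₁ x).add (hh₂ x)
  smul_mem' c h hh x := by
    simp only [ContinuousMap.smul_apply, smul_eq_mul, ← Finset.mul_sum, mul_div_assoc]
    rw [integral_const_mul]
    exact (hh x).const_mul c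

end Continuous

/-- Continuous functions with everywhere convergent averages are dense in `L²`. -/
theorem dense_map_toLp_convergenceSubmodule [Group G] [Countable G] [DecidableEq G]
    [MetricSpace X] [CompactSpace X] [MeasurableSpace X] [BorelSpace X] {act : G → X → X}
    (hact_mul : ∀ g h x, act (g * h) x = act g (act h x))
    (hact_cont : ∀ g, Continuous (act g)) {Fs : ℕ → Finset G} (hFol : Folner Fs)
    {μ : Measure X} [IsProbabilityMeasure μ] (hact : ∀ g, MeasurePreserving (act g) μ μ)
    (herg : ErgodicAction act μ) :
    ((convergenceSubmodule act Fs μ).map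
      (ContinuousMap.toLp (E := ℝ) 2 μ ℝ).toLinearMap).topologicalClosure = ⊤ := by
  rw [Submodule.topologicalClosure_eq_top_iff, Submodule.eq_bot_iff]
  intro k hk
  rw [Submodule.mem_orthogonal'] at hk
  have hperp : ∀ h ∈ convergenceSubmodule act Fs μ,
      inner ℝ k (ContinuousMap.toLp (E := ℝ) 2 μ ℝ h) = 0 :=
    fun h hh => hk _ (Submodule.mem_map_of_mem hh)
  have hint_comp : ∀ (g : G) (h : C(X, ℝ)), ∫ x, h (act g x) ∂μ = ∫ x, h x ∂μ := by
    intro g h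
    conv_rhs => rw [← (hact g).map_eq]
    rw [integral_map (hact g).aemeasurable h.continuous.aestronglyMeasurable]
  have hi : ∀ h : C(X, ℝ), Integrable h μ := fun h =>
    h.continuous.integrable_of_hasCompactSupport (HasCompactSupport.of_compactSpace h)
  have hinv : ∀ g, Lp.compMeasurePreserving (act g) (hact g) k = k := by
    intro g
    have hcob : ∀ h : C(X, ℝ), inner ℝ k (Lp.compMeasurePreservingₗᵢ ℝ (act g) (hact g)
        (ContinuousMap.toLp (E := ℝ) 2 μ ℝ h)) =
        inner ℝ k (ContinuousMap.toLp (E := ℝ) 2 μ ℝ h) := by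
      intro h
      set h' : C(X, ℝ) := h.comp ⟨act g, hact_cont g⟩ with hh'
      have hmem : h' - h ∈ convergenceSubmodule act Fs μ := by
        intro x
        have h0 : ∫ y, (h' - h) y ∂μ = 0 := by
          simp only [ContinuousMap.sub_apply]
          rw [integral_sub (hi h') (hi h), sub_eq_zero]
          exact hint_comp g h
        rw [h0]
        exact tendsto_average_coboundary hact_mul hFol (fun y => h.norm_coe_le_norm y) g x
      have heq : Lp.compMeasurePreservingₗᵢ ℝ (act g) (hact g)
          (ContinuousMap.toLp (E := ℝ) 2 μ ℝ h) = ContinuousMap.toLp (E := ℝ) 2 μ ℝ h' := by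
        apply Lp.ext
        have h1 := (hact g).quasiMeasurePreserving.ae (ContinuousMap.coeFn_toLp (𝕜 := ℝ)
          (p := 2) μ h)
        filter_upwards [Lp.coeFn_compMeasurePreserving (ContinuousMap.toLp (E := ℝ) 2 μ ℝ h)
          (hact g), h1, ContinuousMap.coeFn_toLp (𝕜 := ℝ) (p := 2) μ h'] with x hx1 hx2 hx3
        rw [hx3]
        exact hx1.trans hx2
      have := hperp _ hmem
      rw [map_sub, inner_sub_right, sub_eq_zero] at this
      rw [heq, this]
    have hall := (ContinuousMap.toLp_denseRange ℝ μ ℝ (p := 2) (by simp)).equalizer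
      (g := fun v : Lp ℝ 2 μ => inner ℝ k (Lp.compMeasurePreservingₗᵢ ℝ (act g) (hact g) v))
      (h := fun v : Lp ℝ 2 μ => inner ℝ k v)
      (continuous_const.inner (Lp.compMeasurePreservingₗᵢ ℝ (act g) (hact g)).continuous)
      (continuous_const.inner continuous_id) (funext hcob)
    have hkk := congrFun hall k
    set U : Lp ℝ 2 μ →ₗᵢ[ℝ] Lp ℝ 2 μ := Lp.compMeasurePreservingₗᵢ ℝ (act g) (hact g)
    change U k = k
    rw [← sub_eq_zero, ← norm_eq_zero, ← sq_eq_zero_iff, norm_sub_sq_real, U.norm_map,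
      real_inner_comm, hkk, real_inner_self_eq_norm_sq]
    ring
  have hkint : Integrable k μ := (Lp.memLp k).integrable (by norm_num)
  have hkm : Measurable k := (Lp.stronglyMeasurable k).measurable
  have hone : (1 : C(X, ℝ)) ∈ convergenceSubmodule act Fs μ := by
    intro x
    refine tendsto_const_nhds.congr fun n => ?_
    have : ((Fs n).card : ℝ) ≠ 0 := by simpa [Finset.card_eq_zero] using (hFol.1 n).ne_empty
    simp [this]
  have hzero : ∫ x, k x ∂μ = 0 := by
    rw [← hperp 1 hone, L2.inner_def]
    refine integral_congr_ae ?_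
    filter_upwards [ContinuousMap.coeFn_toLp (𝕜 := ℝ) (p := 2) μ (1 : C(X, ℝ))] with x hx
    rw [hx]
    simp
  refine (Lp.eq_zero_iff_ae_eq_zero).2 (ae_eq_zero_of_ae_invariant hact_mul
    (fun g => (hact g).measurable) herg hkm hkint (fun g => ?_) hzero)
  have := Lp.coeFn_compMeasurePreserving k (hact g)
  rw [hinv g] at this
  filter_upwards [this] with x hx
  exact hx.symm

theorem exists_convergenceSubmodule_integral_abs_sub_lt [Group G] [Countable G] [DecidableEq G]
    [MetricSpace X] [CompactSpace X] [MeasurableSpace X] [BorelSpace X] {act : G → X → X}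
    (hact_mul : ∀ g h x, act (g * h) x = act g (act h x))
    (hact_cont : ∀ g, Continuous (act g)) {Fs : ℕ → Finset G} (hFol : Folner Fs)
    {μ : Measure X} [IsProbabilityMeasure μ] (hact : ∀ g, MeasurePreserving (act g) μ μ)
    (herg : ErgodicAction act μ) (f : C(X, ℝ)) {ε : ℝ≥0∞} (hε : 0 < ε) :
    ∃ h ∈ convergenceSubmodule act Fs μ, ∫⁻ x, ‖f x - h x‖ₑ ∂μ < ε := by
  have hmem : ContinuousMap.toLp (E := ℝ) 2 μ ℝ f ∈ closure
      (((convergenceSubmodule act Fs μ).map (ContinuousMap.toLp (E := ℝ) 2 μ ℝ).toLinearMap :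
        Submodule ℝ (Lp ℝ 2 μ)) : Set (Lp ℝ 2 μ)) := by
    rw [← Submodule.topologicalClosure_coe, dense_map_toLp_convergenceSubmodule hact_mul
      hact_cont hFol hact herg]
    trivial
  obtain ⟨_, ⟨h, hh, rfl⟩, hlt⟩ := EMetric.mem_closure_iff.1 hmem ε hε
  refine ⟨h, hh, lt_of_le_of_lt ?_ hlt⟩
  rw [Lp.edist_def]
  have hae : (⇑(ContinuousMap.toLp (E := ℝ) 2 μ ℝ f) -
      ⇑(ContinuousMap.toLp (E := ℝ) 2 μ ℝ h)) =ᵐ[μ] fun x => f x - h x :=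
    (ContinuousMap.coeFn_toLp (𝕜 := ℝ) (p := 2) μ f).sub
      (ContinuousMap.coeFn_toLp (𝕜 := ℝ) (p := 2) μ h)
  refine le_trans ?_ (le_of_eq (eLpNorm_congr_ae hae).symm)
  rw [← eLpNorm_one_eq_lintegral_enorm]
  exact eLpNorm_le_eLpNorm_of_exponent_le (by norm_num)
    (f - h).continuous.aestronglyMeasurable

/-- The pointwise ergodic theorem for a continuous function. -/
theorem ae_tendsto_average [Group G] [Countable G] [DecidableEq G]
    [MetricSpace X] [CompactSpace X] [MeasurableSpace X] [BorelSpace X] {act : G → X → X}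
    (hact_one : ∀ x, act 1 x = x) (hact_mul : ∀ g h x, act (g * h) x = act g (act h x))
    (hact_cont : ∀ g, Continuous (act g)) {Fs : ℕ → Finset G} (hFol : Folner Fs)
    (htemp : Tempered Fs) {μ : Measure X} [IsProbabilityMeasure μ]
    (hact : ∀ g, MeasurePreserving (act g) μ μ) (herg : ErgodicAction act μ) (f : C(X, ℝ)) :
    ∀ᵐ x ∂μ, Tendsto (fun n => (∑ g ∈ Fs n, f (act g x)) / ((Fs n).card : ℝ)) atTop
      (𝓝 (∫ y, f y ∂μ)) := by
  have hi : ∀ h : C(X, ℝ), Integrable h μ := fun h =>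
    h.continuous.integrable_of_hasCompactSupport (HasCompactSupport.of_compactSpace h)
  obtain ⟨C, hC0, hC⟩ := htemp
  have hC' : ∀ n, (((Finset.range n).biUnion fun k => (Fs k)⁻¹ * Fs n).card : ℝ≥0∞)
      ≤ ENNReal.ofReal C * ((Fs n).card : ℝ≥0∞) := by
    intro n
    rw [← ENNReal.ofReal_natCast, ← ENNReal.ofReal_natCast, ← ENNReal.ofReal_mul hC0.le]
    exact ENNReal.ofReal_le_ofReal (hC n)
  have hsmall : ∀ δ : ℝ, 0 < δ → ∀ᵐ x ∂μ, ∀ᶠ n in atTop,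
      |(∑ g ∈ Fs n, f (act g x)) / ((Fs n).card : ℝ) - ∫ y, f y ∂μ| < 3 * δ := by
    intro δ hδ
    rw [ae_iff]
    set B := {x | ¬ ∀ᶠ n in atTop,
      |(∑ g ∈ Fs n, f (act g x)) / ((Fs n).card : ℝ) - ∫ y, f y ∂μ| < 3 * δ} with hB
    have hδ' : ENNReal.ofReal δ ≠ 0 := by simpa using hδ
    have hbound : ∀ ε : ℝ≥0, 0 < ε → ENNReal.ofReal δ * μ B ≤ (1 + ENNReal.ofReal C) * ε := by
      intro ε hε
      obtain ⟨h, hh, hlt⟩ := exists_convergenceSubmodule_integral_abs_sub_lt hact_mul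
        hact_cont hFol hact herg f (ε := min ε (ENNReal.ofReal δ))
        (lt_min (by exact_mod_cast hε) (by simpa using hδ))
      have hmax := mul_measure_exists_lt_sum_le hact_one hact_mul hact hFol.1 hC'
        (f := fun x => ‖f x - h x‖ₑ) (f - h).continuous.measurable.enorm (ENNReal.ofReal δ)
      refine le_trans (mul_le_mul_right (measure_mono ?_) _) (hmax.trans
        (mul_le_mul_right (hlt.le.trans (min_le_left _ _)) _))
      intro x hx
      by_contra hxn
      refine hx ?_
      have hxn' : ∀ n, ∑ g ∈ Fs n, |f (act g x) - h (act g x)| ≤ δ * ((Fs n).card : ℝ) := by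
        intro n
        by_contra hcon
        refine hxn ⟨n, ?_⟩
        have := (ENNReal.ofReal_lt_ofReal_iff_of_nonneg (by positivity)).2 (not_le.1 hcon)
        rw [ENNReal.ofReal_mul hδ.le, ENNReal.ofReal_natCast,
          ENNReal.ofReal_sum_of_nonneg fun _ _ => abs_nonneg _] at this
        simpa only [← Real.norm_eq_abs, ofReal_norm] using this
      have hintle : |∫ y, f y ∂μ - ∫ y, h y ∂μ| ≤ δ := by
        rw [← integral_sub (hi f) (hi h), ← Real.norm_eq_abs, ← ENNReal.ofReal_le_ofReal_iff hδ.le,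
          ofReal_norm]
        exact (enorm_integral_le_lintegral_enorm _).trans (hlt.le.trans (min_le_right _ _))
      filter_upwards [Metric.tendsto_nhds.1 (hh x) δ hδ] with n hn
      rw [Real.dist_eq] at hn
      have hc : (0 : ℝ) < (Fs n).card := by exact_mod_cast (hFol.1 n).card_pos
      have havg : |(∑ g ∈ Fs n, f (act g x)) / ((Fs n).card : ℝ) -
          (∑ g ∈ Fs n, h (act g x)) / ((Fs n).card : ℝ)| ≤ δ := by
        rw [← sub_div, ← Finset.sum_sub_distrib, abs_div, abs_of_pos hc, div_le_iff₀ hc]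
        exact (Finset.abs_sum_le_sum_abs _ _).trans (hxn' n)
      rw [abs_lt] at hn ⊢
      rw [abs_le] at havg hintle
      constructor <;> linarith [hn.1, hn.2, havg.1, havg.2, hintle.1, hintle.2]
    have hfin : (1 + ENNReal.ofReal C) ≠ ∞ := by simp
    have hzero : ENNReal.ofReal δ * μ B = 0 := by
      by_contra hne
      obtain ⟨ε, hε, hlt⟩ := ENNReal.exists_nnreal_pos_mul_lt hfin hne
      exact absurd (hbound ε hε) (not_le.2 (by rwa [mul_comm]))
    exact (mul_eq_zero.1 hzero).resolve_left hδ'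
  have hall := ae_all_iff.2 fun j : ℕ => hsmall (1 / ((j : ℝ) + 1)) (by positivity)
  filter_upwards [hall] with x hx
  rw [Metric.tendsto_nhds]
  intro ε hε
  obtain ⟨j, hj⟩ := exists_nat_one_div_lt (show 0 < ε / 3 by positivity)
  filter_upwards [hx j] with n hn
  rw [Real.dist_eq]
  linarith

theorem generic_points_full_measure
    [Group G] [Countable G] [Infinite G] [DecidableEq G]
    [MetricSpace X] [CompactSpace X] [MeasurableSpace X] [BorelSpace X]
    (act : G → X → X)
    (hact_one : ∀ x, act 1 x = x)
    (hact_mul : ∀ g h x, act (g * h) x = act g (act h x))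
    (hact_cont : ∀ g : G, Continuous (act g))
    (Fs : ℕ → Finset G) (hFol : Folner Fs) (htemp : Tempered Fs)
    (μ : Measure X) [IsProbabilityMeasure μ] (hinv : InvariantMeasure act μ)
    (herg : ErgodicAction act μ) :
    μ (genericPoints act Fs μ) = 1 := by
  have hact : ∀ g, MeasurePreserving (act g) μ μ := fun g =>
    ⟨(hact_cont g).measurable, Measure.ext fun s hs => by
      rw [Measure.map_apply (hact_cont g).measurable hs, hinv g s hs]⟩
  have hae : ∀ᵐ x ∂μ, x ∈ genericPoints act Fs μ := by
    have hall := ae_all_iff.2 fun j => ae_tendsto_average hact_one hact_mul hact_cont hFol htemp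
      hact herg (TopologicalSpace.denseSeq C(X, ℝ) j)
    filter_upwards [hall] with x hx f
    have hi : ∀ h : C(X, ℝ), Integrable h μ := fun h =>
      h.continuous.integrable_of_hasCompactSupport (HasCompactSupport.of_compactSpace h)
    rw [Metric.tendsto_nhds]
    intro ε hε
    obtain ⟨_, hj, ⟨j, rfl⟩⟩ := Metric.dense_iff.1 (TopologicalSpace.denseRange_denseSeq C(X, ℝ)) f
      (ε / 3) (by positivity)
    set h := TopologicalSpace.denseSeq C(X, ℝ) j
    have hdist : ∀ y, |f y - h y| ≤ ε / 3 := fun y => by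
      rw [← Real.dist_eq, dist_comm]
      exact (ContinuousMap.dist_apply_le_dist y).trans (Metric.mem_ball.1 hj).le
    have hintle : |∫ y, f y ∂μ - ∫ y, h y ∂μ| ≤ ε / 3 := by
      rw [← integral_sub (hi f) (hi h), ← Real.norm_eq_abs]
      simpa using norm_integral_le_of_norm_le_const (μ := μ)
        (f := fun y => f y - h y) (Eventually.of_forall hdist)
    filter_upwards [Metric.tendsto_nhds.1 (hx j) (ε / 3) (by positivity)] with n hn
    rw [Real.dist_eq] at hn ⊢
    have hc : (0 : ℝ) < (Fs n).card := by exact_mod_cast (hFol.1 n).card_pos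
    have havg : |(∑ g ∈ Fs n, f (act g x)) / ((Fs n).card : ℝ) -
        (∑ g ∈ Fs n, h (act g x)) / ((Fs n).card : ℝ)| ≤ ε / 3 := by
      rw [← sub_div, ← Finset.sum_sub_distrib, abs_div, abs_of_pos hc, div_le_iff₀ hc, mul_comm,
        ← nsmul_eq_mul]
      exact (Finset.abs_sum_le_sum_abs _ _).trans
        (Finset.sum_le_card_nsmul _ _ _ fun g _ => hdist _)
    rw [abs_lt] at hn ⊢
    rw [abs_le] at havg hintle
    constructor <;> linarith [hn.1, hn.2, havg.1, havg.2, hintle.1, hintle.2]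
  exact (measure_congr (eventuallyEq_univ.2 hae)).trans measure_univ

end AmenablePacking
end

section
/- Dimensional entropies equal dimensions in symbolic systems: Let A be a finite set with |A| ≥ 2 and A^G the G-symbolic space with the left shift action (g'x)_g = x_{gg'}. Fix a tempered Følner sequence {F_n} in G with F_0 = {e_G} ⊊ F_1 ⊊ F_2 ⊊ …, ⋃_n F_n = G, satisfying (1) F_m F_n ⊆ F_{m+n} for all m,n ∈ ℕ and (2) lim_n |F_{n+1}|/|F_n| = 1. Then for any E ⊆ A^G, h^B_top(E,{F_n}) = dim_H E and h^P_top(E,{F_n}) = dim_P E, where dim_H and dim_P are the Hausdorff and packing dimensions with respect to the metric d on A^G defined by d(x,y) = 1 if x and y disagree on F_0, and otherwise d(x,y) = e^{−|F_n|} where n = max{k : x|_{F_k} = y|_{F_k}}. -/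
open Filter Set MeasureTheory ENNReal Topology
open scoped Pointwise symmDiff NNReal

namespace AmenablePacking

variable {G X Y : Type*}

/-- The packing pre-measure `P^s_ε(E)` in the sense of geometric measure theory:
the supremum of `∑ᵢ (diam Bᵢ)^s` over disjoint families of closed balls of diameter at most
`ε` with centers in `E`. -/
noncomputable def packDimPre [PseudoMetricSpace X] (E : Set X) (ε s : ℝ) : ℝ≥0∞ :=
  ⨆ (t : Set ℕ) (c : ℕ → X × ℝ)
    (_ : ∀ i ∈ t, (c i).1 ∈ E ∧ 0 ≤ (c i).2 ∧
      Metric.diam (Metric.closedBall (c i).1 (c i).2) ≤ ε)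
    (_ : ∀ i ∈ t, ∀ j ∈ t, i ≠ j →
      Disjoint (Metric.closedBall (c i).1 (c i).2) (Metric.closedBall (c j).1 (c j).2)),
    ∑' i : t, ENNReal.ofReal (Metric.diam (Metric.closedBall (c (i : ℕ)).1 (c (i : ℕ)).2) ^ s)

/-- `P^s(E) = lim_{ε → 0} P^s_ε(E)` (the quantity is non-decreasing in `ε`). -/
noncomputable def packDimP [PseudoMetricSpace X] (E : Set X) (s : ℝ) : ℝ≥0∞ :=
  ⨅ (ε : ℝ) (_ : 0 < ε), packDimPre E ε s

/-- The packing measure `𝒫^s(E) = inf {∑ᵢ P^s(Eᵢ) : E = ⋃ᵢ Eᵢ}`. -/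
noncomputable def packDimOuter [PseudoMetricSpace X] (E : Set X) (s : ℝ) : ℝ≥0∞ :=
  ⨅ (Es : ℕ → Set X) (_ : E = ⋃ i, Es i), ∑' i, packDimP (Es i) s

/-- The packing dimension `dim_P E = inf {s ≥ 0 : 𝒫^s(E) = 0}`. -/
noncomputable def packDim [PseudoMetricSpace X] (E : Set X) : ℝ≥0∞ :=
  ⨅ (s : ℝ≥0) (_ : packDimOuter E (s : ℝ) = 0), (s : ℝ≥0∞)

/-- The radius `exp (-|F_n|)` of the cylinders over `F_n`. -/
noncomputable def cylRadius (Fs : ℕ → Finset G) (n : ℕ) : ℝ :=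
  Real.exp (-((Fs n).card : ℝ))

lemma cylRadius_pos (Fs : ℕ → Finset G) (n : ℕ) : 0 < cylRadius Fs n := Real.exp_pos _

lemma cylRadius_rpow (Fs : ℕ → Finset G) (n : ℕ) (s : ℝ) :
    cylRadius Fs n ^ s = Real.exp (-s * ((Fs n).card : ℝ)) := by
  rw [cylRadius, ← Real.exp_mul]
  ring_nf

/-- The metric properties of symbolic systems that relate Bowen balls over `F_n` to metric balls
of radius `exp (-|F_n|)`. -/
structure IsCylindrical [PseudoMetricSpace X] (act : G → X → X) (Fs : ℕ → Finset G) : Prop where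
  card_strictMono : StrictMono fun n => (Fs n).card
  ratio : Tendsto (fun n => ((Fs (n + 1)).card : ℝ) / ((Fs n).card : ℝ)) atTop (𝓝 1)
  diam_closedBall : ∀ (x : X) (n : ℕ), Metric.diam (Metric.closedBall x (cylRadius Fs n)) = cylRadius Fs n
  closedBall_eq : ∀ r : ℝ, 0 < r → r < 1 → ∃ n, cylRadius Fs n ≤ r ∧
    ∀ x : X, Metric.closedBall x r = Metric.closedBall x (cylRadius Fs n)
  dynBall_subset : ∀ (x : X) (n : ℕ), dynBall act (Fs n) x 1 ⊆ Metric.closedBall x (cylRadius Fs n)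
  subset_dynBall : ∀ ε : ℝ, 0 < ε → ∃ m, ∀ (x : X) (n : ℕ),
    Metric.closedBall x (cylRadius Fs (n + m)) ⊆ dynBall act (Fs n) x ε

namespace IsCylindrical

variable [PseudoMetricSpace X] {act : G → X → X} {Fs : ℕ → Finset G}

lemma cylRadius_strictAnti (h : IsCylindrical act Fs) : StrictAnti (cylRadius Fs) := by
  intro m n hmn
  have := h.card_strictMono hmn
  simp only [cylRadius, Real.exp_lt_exp, neg_lt_neg_iff]
  exact_mod_cast this

lemma tendsto_cylRadius (h : IsCylindrical act Fs) : Tendsto (cylRadius Fs) atTop (𝓝 0) :=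
  Real.tendsto_exp_neg_atTop_nhds_zero.comp
    (tendsto_natCast_atTop_atTop.comp h.card_strictMono.tendsto_atTop)

lemma ediam_closedBall (h : IsCylindrical act Fs) (x : X) (n : ℕ) :
    Metric.ediam (Metric.closedBall x (cylRadius Fs n)) = ENNReal.ofReal (cylRadius Fs n) := by
  have := congrArg ENNReal.ofReal (h.diam_closedBall x n)
  rwa [Metric.diam, ENNReal.ofReal_toReal Metric.isBounded_closedBall.ediam_ne_top] at this

lemma tendsto_card_add_div (h : IsCylindrical act Fs) (m : ℕ) :
    Tendsto (fun n => ((Fs (n + m)).card : ℝ) / ((Fs n).card : ℝ)) atTop (𝓝 1) := by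
  have hpos : ∀ n, 1 ≤ n → ((Fs n).card : ℝ) ≠ 0 := fun n hn => by
    have : n ≤ (Fs n).card := h.card_strictMono.le_apply
    have : 0 < (Fs n).card := by omega
    positivity
  induction m with
  | zero =>
    refine tendsto_const_nhds.congr' ?_
    filter_upwards [eventually_ge_atTop 1] with n hn
    exact (div_self (hpos n hn)).symm
  | succ m ih =>
    have := (h.ratio.comp (tendsto_add_atTop_nat m)).mul ih
    rw [one_mul] at this
    refine this.congr' ?_
    filter_upwards [eventually_ge_atTop 1] with n hn
    have h1 := hpos (n + m) (by omega)
    simp only [Function.comp_apply, ← add_assoc]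
    field_simp

lemma exists_forall_exp_le (h : IsCylindrical act Fs) (m : ℕ) {s t : ℝ} (hst : s < t) :
    ∃ N, ∀ n, N ≤ n → Real.exp (-t * ((Fs n).card : ℝ)) ≤ cylRadius Fs (n + m) ^ s := by
  have hlim := (h.tendsto_card_add_div m).const_mul s
  rw [mul_one] at hlim
  obtain ⟨N, hN⟩ := eventually_atTop.1 ((hlim.eventually (gt_mem_nhds hst)).and
    (eventually_ge_atTop 1))
  refine ⟨N, fun n hn => ?_⟩
  obtain ⟨h1, h2⟩ := hN n hn
  have hpos : (0 : ℝ) < (Fs n).card := by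
    have : n ≤ (Fs n).card := h.card_strictMono.le_apply
    exact_mod_cast (by omega : 0 < (Fs n).card)
  rw [cylRadius_rpow, Real.exp_le_exp, ← mul_div_assoc, div_lt_iff₀ hpos] at *
  linarith

lemma packDimPre_le_packP (h : IsCylindrical act Fs) (Z : Set X) {N : ℕ} (hN : 1 ≤ N)
    {s : ℝ} (hs : 0 < s) {ε : ℝ} (hε : ε < 1) :
    packDimPre Z (cylRadius Fs N) s ≤ packP act Fs Z N ε s := by
  refine iSup_le fun t => iSup_le fun c => iSup_le fun hc => iSup_le fun hdisj => ?_
  have key : ∀ i, ∃ n, i ∈ t → 0 < (c i).2 → N ≤ n ∧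
      Metric.closedBall (c i).1 (c i).2 = Metric.closedBall (c i).1 (cylRadius Fs n) := by
    intro i
    by_cases hi : i ∈ t ∧ 0 < (c i).2
    swap
    · exact ⟨0, fun h1 h2 => absurd ⟨h1, h2⟩ hi⟩
    obtain ⟨hit, hr⟩ := hi
    have hd := (hc i hit).2.2
    have hr1 : (c i).2 < 1 := by
      by_contra! hge
      have h0 : cylRadius Fs 0 ≤ (c i).2 := le_trans (by simp [cylRadius]) hge
      have := Metric.diam_mono (Metric.closedBall_subset_closedBall (x := (c i).1) h0)
        Metric.isBounded_closedBall
      rw [h.diam_closedBall] at this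
      exact absurd (h.cylRadius_strictAnti (show 0 < N by omega)) (not_lt.2 (this.trans hd))
    obtain ⟨n, -, hn⟩ := h.closedBall_eq _ hr hr1
    refine ⟨n, fun _ _ => ⟨?_, hn _⟩⟩
    rw [hn, h.diam_closedBall] at hd
    exact h.cylRadius_strictAnti.le_iff_ge.1 hd
  choose n hn using key
  set t' : Set ℕ := {i | i ∈ t ∧ 0 < (c i).2} with ht'
  have hsub : ∀ i ∈ t', dynClosedBall act (Fs (n i)) (c i).1 ε ⊆
      Metric.closedBall (c i).1 (c i).2 := by
    intro i hi
    rw [(hn i hi.1 hi.2).2]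
    exact Subset.trans (fun y hy g hg => (hy g hg).trans_lt hε) (h.dynBall_subset _ _)
  calc ∑' i : t, ENNReal.ofReal (Metric.diam (Metric.closedBall (c i).1 (c i).2) ^ s)
      ≤ ∑' i : t', ENNReal.ofReal (Real.exp (-s * ((Fs (n i)).card : ℝ))) := by
        rw [tsum_subtype t
            (fun i => ENNReal.ofReal (Metric.diam (Metric.closedBall (c i).1 (c i).2) ^ s)),
          tsum_subtype t' (fun i => ENNReal.ofReal (Real.exp (-s * ((Fs (n i)).card : ℝ))))]
        refine ENNReal.tsum_le_tsum fun i => ?_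
        by_cases hi : i ∈ t
        swap
        · simp [hi]
        rw [indicator_of_mem hi]
        rcases (hc i hi).2.1.eq_or_lt with h0 | h0
        · have hle : Metric.diam (Metric.closedBall (c i).1 (c i).2) ≤ 2 * (c i).2 :=
            Metric.diam_closedBall (hc i hi).2.1
          rw [← h0, mul_zero] at hle
          rw [← h0, le_antisymm hle Metric.diam_nonneg, Real.zero_rpow hs.ne']
          simp
        · rw [indicator_of_mem (show i ∈ t' from ⟨hi, h0⟩), (hn i hi h0).2, h.diam_closedBall,
            cylRadius_rpow]
    _ ≤ packP act Fs Z N ε s := by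
        refine le_iSup_of_le t' (le_iSup_of_le (fun i => ((c i).1, n i)) ?_)
        refine le_iSup_of_le (fun i hi => ⟨(hc i hi.1).1, (hn i hi.1 hi.2).1⟩) ?_
        refine le_iSup_of_le (fun i hi j hj hij => ?_) le_rfl
        exact (hdisj i hi.1 j hj.1 hij).mono (hsub i hi) (hsub j hj)

lemma packDimOuter_le_packOuter (h : IsCylindrical act Fs) (Z : Set X)
    {s : ℝ} (hs : 0 < s) {ε : ℝ} (hε : ε < 1) :
    packDimOuter Z s ≤ packOuter act Fs Z ε s := by
  refine le_iInf fun Zs => le_iInf fun hZ => ?_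
  refine iInf_le_of_le (fun i => Z ∩ Zs i) (iInf_le_of_le ?_ (ENNReal.tsum_le_tsum fun i => ?_))
  · rw [← inter_iUnion, inter_eq_left.2 hZ]
  · refine le_iInf fun N => ?_
    calc packDimP (Z ∩ Zs i) s ≤ packDimPre (Z ∩ Zs i) (cylRadius Fs (N + 1)) s :=
          iInf_le_of_le _ (iInf_le _ (cylRadius_pos _ _))
      _ ≤ packP act Fs (Z ∩ Zs i) (N + 1) ε s :=
          h.packDimPre_le_packP _ (by omega) hs hε
      _ ≤ packP act Fs (Zs i) N ε s := by
          refine iSup_mono fun t => iSup_mono fun c => iSup_mono' fun hc => ⟨fun i hi => ?_, le_rfl⟩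
          exact ⟨(hc i hi).1.2, (Nat.le_succ N).trans (hc i hi).2⟩

lemma packOuter_le_packDimOuter (h : IsCylindrical act Fs) (Z : Set X) {s t : ℝ} (hst : s < t)
    {ε : ℝ} (hε : 0 < ε) : packOuter act Fs Z ε t ≤ packDimOuter Z s := by
  obtain ⟨m, hm⟩ := h.subset_dynBall ε hε
  obtain ⟨N₀, hN₀⟩ := h.exists_forall_exp_le m hst
  refine le_iInf fun Zs => le_iInf fun hZ => ?_
  refine iInf_le_of_le Zs (iInf_le_of_le hZ.subset (ENNReal.tsum_le_tsum fun i => ?_))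
  refine le_iInf fun δ => le_iInf fun hδ => ?_
  obtain ⟨N₁, hN₁⟩ := eventually_atTop.1 (h.tendsto_cylRadius.eventually (gt_mem_nhds hδ))
  refine iInf_le_of_le (max N₀ N₁) ?_
  refine iSup_le fun u => iSup_le fun c => iSup_le fun hc => iSup_le fun hdisj => ?_
  have hsub : ∀ i, Metric.closedBall (c i).1 (cylRadius Fs ((c i).2 + m)) ⊆
      dynClosedBall act (Fs (c i).2) (c i).1 ε := fun i =>
    (hm _ _).trans fun y hy g hg => (hy g hg).le
  refine le_iSup_of_le u (le_iSup_of_le (fun i => ((c i).1, cylRadius Fs ((c i).2 + m))) ?_)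
  refine le_iSup_of_le (fun i hi => ⟨(hc i hi).1, (cylRadius_pos _ _).le, ?_⟩) ?_
  · have := (hc i hi).2
    rw [h.diam_closedBall]
    exact (hN₁ _ (by omega)).le
  refine le_iSup_of_le (fun i hi j hj hij => (hdisj i hi j hj hij).mono (hsub i) (hsub j)) ?_
  refine ENNReal.tsum_le_tsum fun i => ENNReal.ofReal_le_ofReal ?_
  rw [h.diam_closedBall]
  exact hN₀ _ ((le_max_left _ _).trans (hc i i.2).2)

lemma packEnt_eq_packDim (h : IsCylindrical act Fs) (Z : Set X) :
    packEnt act Fs Z = packDim Z := by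
  apply le_antisymm
  · refine iSup_le fun ε => iSup_le fun hε => le_iInf fun s => le_iInf fun hs => ?_
    refine le_of_forall_gt_imp_ge_of_dense fun b hb => ?_
    obtain ⟨t, hst, htb⟩ := ENNReal.lt_iff_exists_nnreal_btwn.1 hb
    have hst' : (s : ℝ) < t := by exact_mod_cast hst
    refine (iInf_le_of_le t (iInf_le _ ?_)).trans htb.le
    exact le_antisymm ((h.packOuter_le_packDimOuter Z hst' hε).trans hs.le) bot_le
  · refine le_iSup_of_le (1 / 2 : ℝ) (le_iSup_of_le (by norm_num) ?_)
    refine le_iInf fun s => le_iInf fun hs => ?_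
    refine le_of_forall_gt_imp_ge_of_dense fun b hb => ?_
    obtain ⟨t, hst, htb⟩ := ENNReal.lt_iff_exists_nnreal_btwn.1 hb
    have hst' : s < t := by exact_mod_cast hst
    have ht0 : (0 : ℝ) < t := lt_of_le_of_lt s.2 (by exact_mod_cast hst')
    refine (iInf_le_of_le t (iInf_le _ ?_)).trans htb.le
    have hmono : packOuter act Fs Z (1 / 2) t ≤ packOuter act Fs Z (1 / 2) s := by
      refine iInf_mono fun Zs => iInf_mono fun _ => ENNReal.tsum_le_tsum fun i =>
        iInf_mono fun N => iSup_mono fun u => iSup_mono fun c => iSup_mono fun _ =>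
        iSup_mono fun _ => ENNReal.tsum_le_tsum fun j =>
        ENNReal.ofReal_le_ofReal (Real.exp_le_exp.2 ?_)
      have : (s : ℝ) ≤ t := by exact_mod_cast hst'.le
      have := mul_le_mul_of_nonneg_right this (Nat.cast_nonneg (α := ℝ) (Fs (c j).2).card)
      linarith
    exact le_antisymm ((h.packDimOuter_le_packOuter Z ht0 (by norm_num)).trans
      (hmono.trans hs.le)) bot_le

end IsCylindrical

namespace IsCylindrical

variable [MetricSpace X] {act : G → X → X} {Fs : ℕ → Finset G}

lemma hausdorffMeasure_le_bowenMLim [MeasurableSpace X] [BorelSpace X]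
    (h : IsCylindrical act Fs) (E : Set X) {s : ℝ} (hs : 0 ≤ s) :
    Measure.hausdorffMeasure s E ≤ bowenMLim act Fs E s := by
  rw [Measure.hausdorffMeasure_apply]
  refine iSup_le fun r => iSup_le fun hr => ?_
  have hlim : Tendsto (fun n => ENNReal.ofReal (cylRadius Fs n)) atTop (𝓝 0) := by
    simpa using ENNReal.tendsto_ofReal h.tendsto_cylRadius
  obtain ⟨N, hN⟩ := eventually_atTop.1 (hlim.eventually (gt_mem_nhds hr))
  refine le_iSup_of_le 1 (le_iSup_of_le one_pos (le_iSup_of_le N ?_))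
  refine le_iInf fun t => le_iInf fun c => le_iInf fun hc => le_iInf fun hcov => ?_
  classical
  set U : ℕ → Set X := fun i =>
    if i ∈ t then Metric.closedBall (c i).1 (cylRadius Fs (c i).2) else ∅ with hU
  refine iInf_le_of_le U (iInf_le_of_le ?_ (iInf_le_of_le (fun i => ?_) ?_))
  · intro x hx
    obtain ⟨i, hi, hxi⟩ := mem_iUnion₂.1 (hcov hx)
    refine mem_iUnion.2 ⟨i, ?_⟩
    simp only [hU, if_pos hi]
    exact h.dynBall_subset _ _ hxi
  · by_cases hi : i ∈ t
    · simp only [hU, if_pos hi, h.ediam_closedBall]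
      exact (hN _ (hc i hi)).le
    · simp [hU, hi]
  · rw [tsum_subtype t (fun i => ENNReal.ofReal (Real.exp (-s * ((Fs (c i).2).card : ℝ))))]
    refine ENNReal.tsum_le_tsum fun i => iSup_le fun hne => ?_
    by_cases hi : i ∈ t
    · rw [indicator_of_mem hi, ← cylRadius_rpow,
        ← ENNReal.ofReal_rpow_of_nonneg (cylRadius_pos _ _).le hs]
      simp only [hU, if_pos hi, h.ediam_closedBall]
      exact le_rfl
    · simp [hU, hi] at hne

lemma exists_closedBall_cover (h : IsCylindrical act Fs) {U : Set X} (hU : U.Nonempty) {N : ℕ}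
    (hd : Metric.ediam U ≤ ENNReal.ofReal (cylRadius Fs (N + 1))) {s : ℝ} (hs : 0 < s)
    {δ : ℝ≥0∞} (hδ : 0 < δ) :
    ∃ (x : X) (n : ℕ), N ≤ n ∧ U ⊆ Metric.closedBall x (cylRadius Fs n) ∧
      ENNReal.ofReal (cylRadius Fs n ^ s) ≤ Metric.ediam U ^ s + δ := by
  obtain ⟨x, hx⟩ := hU
  have hfin : Metric.ediam U ≠ ⊤ := ne_top_of_le_ne_top ENNReal.ofReal_ne_top hd
  have hlt : Metric.ediam U < ENNReal.ofReal (cylRadius Fs N) :=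
    hd.trans_lt ((ENNReal.ofReal_lt_ofReal_iff (cylRadius_pos _ _)).2
      (h.cylRadius_strictAnti (Nat.lt_succ_self N)))
  have hlt2 : Metric.ediam U ^ s < Metric.ediam U ^ s + δ :=
    ENNReal.lt_add_right (ENNReal.rpow_ne_top_of_nonneg hs.le hfin) hδ.ne'
  have hev := (ENNReal.continuous_rpow_const (y := s)).continuousAt.eventually
    (gt_mem_nhds hlt2)
  obtain ⟨b, hb, hball⟩ := exists_Ico_subset_of_mem_nhds hev ⟨_, hlt⟩
  obtain ⟨r, hr1, hr2⟩ := ENNReal.lt_iff_exists_nnreal_btwn.1 (lt_min hb hlt)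
  have hr0 : (0 : ℝ) < r := by
    have : (0 : ℝ≥0∞) < r := bot_le.trans_lt hr1
    exact_mod_cast this
  have hrN : (r : ℝ) < cylRadius Fs N := by
    have := hr2.trans_le (min_le_right _ _)
    rwa [← ENNReal.ofReal_coe_nnreal, ENNReal.ofReal_lt_ofReal_iff (cylRadius_pos _ _)] at this
  have hr1' : (r : ℝ) < 1 := hrN.trans_le (by simp [cylRadius])
  obtain ⟨n, hn, hball'⟩ := h.closedBall_eq r hr0 hr1'
  refine ⟨x, n, ?_, ?_, ?_⟩
  · exact (h.cylRadius_strictAnti.lt_iff_gt.1 (hn.trans_lt hrN)).le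
  · rw [← hball' x]
    intro y hy
    have := (Metric.edist_le_ediam_of_mem hy hx).trans hr1.le
    rw [Metric.mem_closedBall, dist_edist]
    exact ENNReal.toReal_le_coe_of_le_coe this
  · have h1 : (r : ℝ≥0∞) ^ s < Metric.ediam U ^ s + δ :=
      hball ⟨hr1.le, hr2.trans_le (min_le_left _ _)⟩
    refine le_trans ?_ h1.le
    rw [← ENNReal.ofReal_rpow_of_nonneg (cylRadius_pos _ _).le hs.le]
    refine ENNReal.rpow_le_rpow ?_ hs.le
    rw [← ENNReal.ofReal_coe_nnreal]
    exact ENNReal.ofReal_le_ofReal hn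

lemma bowenMLim_le_hausdorffMeasure [Nonempty X] [MeasurableSpace X] [BorelSpace X]
    (h : IsCylindrical act Fs) (E : Set X) {s t : ℝ} (hs : 0 < s) (hst : s < t) :
    bowenMLim act Fs E t ≤ Measure.hausdorffMeasure s E := by
  rw [Measure.hausdorffMeasure_apply]
  refine iSup_le fun ε => iSup_le fun hε => iSup_le fun N => ?_
  obtain ⟨m, hm⟩ := h.subset_dynBall ε hε
  obtain ⟨N₀, hN₀⟩ := h.exists_forall_exp_le m hst
  set M := max N N₀ + m with hM
  refine le_iSup_of_le (ENNReal.ofReal (cylRadius Fs (M + 1)))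
    (le_iSup_of_le (ENNReal.ofReal_pos.2 (cylRadius_pos _ _)) ?_)
  refine le_iInf fun U => le_iInf fun hcov => le_iInf fun hdiam => ?_
  refine ENNReal.le_of_forall_pos_le_add fun δ hδ _ => ?_
  obtain ⟨δ', hδ', hsum⟩ := ENNReal.exists_pos_sum_of_countable
    (ENNReal.coe_pos.2 hδ).ne' ℕ
  have key : ∀ i, ∃ p : X × ℕ, (U i).Nonempty → max N N₀ ≤ p.2 ∧
      U i ⊆ Metric.closedBall p.1 (cylRadius Fs (p.2 + m)) ∧
      ENNReal.ofReal (cylRadius Fs (p.2 + m) ^ s) ≤ Metric.ediam (U i) ^ s + δ' i := by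
    intro i
    by_cases hi : (U i).Nonempty
    · obtain ⟨x, n, hn, h1, h2⟩ := h.exists_closedBall_cover hi (hdiam i) hs
        (ENNReal.coe_pos.2 (hδ' i))
      obtain ⟨k, rfl⟩ : ∃ k, n = k + m := ⟨n - m, by omega⟩
      exact ⟨(x, k), fun _ => ⟨by simp only; omega, h1, h2⟩⟩
    · exact ⟨(Classical.arbitrary X, 0), fun h => absurd h hi⟩
  choose c hc using key
  set u : Set ℕ := {i | (U i).Nonempty} with hu
  refine iInf_le_of_le u (iInf_le_of_le c (iInf_le_of_le (fun i hi => ?_)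
    (iInf_le_of_le (fun x hx => ?_) ?_)))
  · exact (le_max_left _ _).trans (hc i hi).1
  · obtain ⟨i, hi⟩ := mem_iUnion.1 (hcov hx)
    exact mem_iUnion₂.2 ⟨i, ⟨x, hi⟩, hm _ _ ((hc i ⟨x, hi⟩).2.1 hi)⟩
  · rw [tsum_subtype u (fun i => ENNReal.ofReal (Real.exp (-t * ((Fs (c i).2).card : ℝ))))]
    refine le_trans ?_ (add_le_add_right hsum.le _)
    rw [← ENNReal.tsum_add]
    refine ENNReal.tsum_le_tsum fun i => ?_
    by_cases hi : (U i).Nonempty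
    · rw [indicator_of_mem (show i ∈ u from hi), iSup_pos hi]
      exact (ENNReal.ofReal_le_ofReal (hN₀ _ ((le_max_right _ _).trans (hc i hi).1))).trans
        (hc i hi).2.2
    · rw [indicator_of_notMem (show i ∉ u from hi)]
      exact bot_le

lemma bowenEnt_eq_dimH [Nonempty X] (h : IsCylindrical act Fs) (E : Set X) :
    bowenEnt act Fs E = dimH E := by
  borelize X
  apply le_antisymm
  · refine le_of_forall_gt_imp_ge_of_dense fun b hb => ?_
    obtain ⟨s, hs, hsb⟩ := ENNReal.lt_iff_exists_nnreal_btwn.1 hb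
    obtain ⟨t, hst, htb⟩ := ENNReal.lt_iff_exists_nnreal_btwn.1 hsb
    have hst' : (s : ℝ) < t := by exact_mod_cast hst
    have hs0 : (0 : ℝ) < s := by
      have : (0 : ℝ≥0∞) < s := bot_le.trans_lt hs
      exact_mod_cast this
    refine (iInf_le_of_le t (iInf_le _ ?_)).trans htb.le
    exact le_antisymm ((h.bowenMLim_le_hausdorffMeasure E hs0 hst').trans
      (hausdorffMeasure_of_dimH_lt hs).le) bot_le
  · refine le_iInf fun s => le_iInf fun hs => dimH_le_of_hausdorffMeasure_ne_top ?_
    have := (h.hausdorffMeasure_le_bowenMLim E s.2).trans hs.le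
    exact ne_top_of_le_ne_top ENNReal.zero_ne_top this

end IsCylindrical

section Symbolic

variable {A : Type*} [MetricSpace (G → A)] {Fs : ℕ → Finset G}

lemma exists_dist_eq_cylRadius (hunion : ∀ g : G, ∃ n, g ∈ Fs n)
    (hd1 : ∀ x y : G → A, (∃ g ∈ Fs 0, x g ≠ y g) → dist x y = 1)
    (hd2 : ∀ x y : G → A, ∀ n : ℕ, (∀ g ∈ Fs n, x g = y g) → (∃ g ∈ Fs (n + 1), x g ≠ y g) →
      dist x y = Real.exp (-((Fs n).card : ℝ))) {x y : G → A} (hxy : x ≠ y) :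
    ∃ k, (∃ g ∈ Fs k, x g ≠ y g) ∧ (∀ j < k, ∀ g ∈ Fs j, x g = y g) ∧
      ((k = 0 ∧ dist x y = 1) ∨ ∃ j, k = j + 1 ∧ dist x y = cylRadius Fs j) := by
  classical
  have hex : ∃ k, ∃ g ∈ Fs k, x g ≠ y g := by
    obtain ⟨g, hg⟩ := Function.ne_iff.1 hxy
    obtain ⟨k, hk⟩ := hunion g
    exact ⟨k, g, hk, hg⟩
  have hmin : ∀ j < Nat.find hex, ∀ g ∈ Fs j, x g = y g := fun j hj g hg => by
    by_contra hne
    exact Nat.find_min hex hj ⟨g, hg, hne⟩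
  refine ⟨Nat.find hex, Nat.find_spec hex, hmin, ?_⟩
  have hspec := Nat.find_spec hex
  rcases hk : Nat.find hex with _ | j
  · rw [hk] at hspec
    exact Or.inl ⟨rfl, hd1 x y hspec⟩
  · rw [hk] at hspec
    exact Or.inr ⟨j, rfl, hd2 x y j (hmin j (by omega)) hspec⟩

lemma dist_le_cylRadius_iff (hmono : StrictMono Fs) (hunion : ∀ g : G, ∃ n, g ∈ Fs n)
    (hne : (Fs 0).Nonempty)
    (hd1 : ∀ x y : G → A, (∃ g ∈ Fs 0, x g ≠ y g) → dist x y = 1)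
    (hd2 : ∀ x y : G → A, ∀ n : ℕ, (∀ g ∈ Fs n, x g = y g) → (∃ g ∈ Fs (n + 1), x g ≠ y g) →
      dist x y = Real.exp (-((Fs n).card : ℝ))) {x y : G → A} {n : ℕ} :
    dist x y ≤ cylRadius Fs n ↔ ∀ g ∈ Fs n, x g = y g := by
  have hanti : StrictAnti (cylRadius Fs) := fun m n hmn => by
    have := Finset.card_lt_card (hmono hmn)
    simp only [cylRadius, Real.exp_lt_exp, neg_lt_neg_iff]
    exact_mod_cast this
  rcases eq_or_ne x y with rfl | hxy
  · simp [(cylRadius_pos Fs n).le]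
  obtain ⟨k, ⟨g, hg, hgne⟩, hmin, hk⟩ := exists_dist_eq_cylRadius hunion hd1 hd2 hxy
  have hiff : (∀ g ∈ Fs n, x g = y g) ↔ n < k := by
    refine ⟨fun hall => ?_, hmin n⟩
    by_contra! hle
    exact hgne (hall g (hmono.monotone hle hg))
  rw [hiff]
  rcases hk with ⟨rfl, hd⟩ | ⟨j, rfl, hd⟩
  · have : cylRadius Fs n < 1 := by
      have := Finset.card_pos.2 (hne.mono (hmono.monotone n.zero_le))
      simpa [cylRadius] using this
    simp [hd, this]
  · rw [hd, hanti.le_iff_ge, Nat.lt_succ_iff]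

/-- The symbolic space `A^G` with the metric associated to `{F_n}` is cylindrical. -/
lemma isCylindrical_shift [Group G] [DecidableEq G] [Nontrivial A]
    (hzero : Fs 0 = {(1 : G)}) (hmono : StrictMono Fs) (hunion : ∀ g : G, ∃ n, g ∈ Fs n)
    (hmulsub : ∀ m n, Fs m * Fs n ⊆ Fs (m + n))
    (hratio : Tendsto (fun n => ((Fs (n + 1)).card : ℝ) / ((Fs n).card : ℝ)) atTop (𝓝 1))
    (hd1 : ∀ x y : G → A, (∃ g ∈ Fs 0, x g ≠ y g) → dist x y = 1)
    (hd2 : ∀ x y : G → A, ∀ n : ℕ, (∀ g ∈ Fs n, x g = y g) → (∃ g ∈ Fs (n + 1), x g ≠ y g) →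
      dist x y = Real.exp (-((Fs n).card : ℝ))) :
    IsCylindrical (fun (g' : G) (x : G → A) => fun g => x (g * g')) Fs := by
  have hcard : StrictMono fun n => (Fs n).card := fun m n hmn => Finset.card_lt_card (hmono hmn)
  have hanti : StrictAnti (cylRadius Fs) := fun m n hmn => by
    have := hcard hmn
    simp only [cylRadius, Real.exp_lt_exp, neg_lt_neg_iff]
    exact_mod_cast this
  have hlim : Tendsto (cylRadius Fs) atTop (𝓝 0) :=
    Real.tendsto_exp_neg_atTop_nhds_zero.comp
      (tendsto_natCast_atTop_atTop.comp hcard.tendsto_atTop)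
  have hiff : ∀ {x y : G → A} {n : ℕ}, dist x y ≤ cylRadius Fs n ↔ ∀ g ∈ Fs n, x g = y g :=
    dist_le_cylRadius_iff hmono hunion (by simp [hzero]) hd1 hd2
  refine ⟨hcard, hratio, fun x n => ?_, fun r hr hr1 => ?_, fun x n y hy => ?_, fun ε hε => ?_⟩
  · apply le_antisymm
    · refine Metric.diam_le_of_forall_dist_le (cylRadius_pos _ _).le fun y hy z hz => ?_
      rw [Metric.mem_closedBall, hiff] at hy hz
      exact hiff.2 fun g hg => (hy g hg).trans (hz g hg).symm
    · classical
      obtain ⟨g, hg, hgn⟩ := Finset.exists_of_ssubset (hmono n.lt_succ_self)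
      obtain ⟨a, ha⟩ := exists_ne (x g)
      have hagree : ∀ k ∈ Fs n, x k = Function.update x g a k := fun k hk => by
        have hkg : k ≠ g := by
          rintro rfl
          exact hgn hk
        rw [Function.update_of_ne hkg]
      have hdist : dist x (Function.update x g a) = cylRadius Fs n :=
        hd2 _ _ n hagree ⟨g, hg, by simpa using ha.symm⟩
      rw [← hdist]
      refine Metric.dist_le_diam_of_mem Metric.isBounded_closedBall
        (Metric.mem_closedBall_self dist_nonneg) ?_
      rw [Metric.mem_closedBall, dist_comm]
  · classical
    have hex : ∃ n, cylRadius Fs n ≤ r :=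
      ((hlim.eventually (gt_mem_nhds hr)).exists).imp fun _ h => h.le
    refine ⟨Nat.find hex, Nat.find_spec hex, fun x => ?_⟩
    refine Subset.antisymm (fun y hy => ?_)
      (Metric.closedBall_subset_closedBall (Nat.find_spec hex))
    rw [Metric.mem_closedBall] at hy ⊢
    rcases eq_or_ne y x with rfl | hxy
    · simpa using (cylRadius_pos _ _).le
    obtain ⟨k, -, -, ⟨rfl, hd⟩ | ⟨j, rfl, hd⟩⟩ := exists_dist_eq_cylRadius hunion hd1 hd2 hxy
    · linarith
    · rw [hd] at hy ⊢
      exact hanti.antitone (Nat.find_min' hex hy)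
  · rw [Metric.mem_closedBall, dist_comm, hiff]
    intro g hg
    by_contra hne
    exact (hy g hg).ne (hd1 _ _ ⟨1, by simp [hzero], by simpa using hne⟩)
  · obtain ⟨m, hm⟩ := (hlim.eventually (gt_mem_nhds hε)).exists
    refine ⟨m, fun x n y hy g hg => lt_of_le_of_lt (hiff.2 fun k hk => ?_) hm⟩
    rw [Metric.mem_closedBall, dist_comm, hiff] at hy
    exact hy _ (by rw [add_comm n m]; exact hmulsub m n (Finset.mul_mem_mul hk hg))

end Symbolic

/-- Dimensional entropies equal dimensions in symbolic systems: for the `G`-symbolic space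
`A^G` with the left shift action `(g' • x)_g = x_{g g'}` and the metric `d` associated to a
tempered Følner sequence `{F_n}` with `F_0 = {e} ⊊ F_1 ⊊ ⋯`, `⋃ F_n = G`,
`F_m F_n ⊆ F_{m+n}` and `|F_{n+1}|/|F_n| → 1`, the Bowen entropy of any `E ⊆ A^G` equals its
Hausdorff dimension and the packing entropy equals its packing dimension. -/
theorem symbolic_dimensional_entropies_eq_dimensions
    {G A : Type*} [Group G] [Countable G] [Infinite G] [DecidableEq G]
    [Fintype A] (hA : 2 ≤ Fintype.card A)
    [MetricSpace (G → A)]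
    (Fs : ℕ → Finset G) (hFol : Folner Fs) (htemp : Tempered Fs)
    (hzero : Fs 0 = {(1 : G)})
    (hchain : ∀ n, Fs n ⊂ Fs (n + 1))
    (hunion : ∀ g : G, ∃ n, g ∈ Fs n)
    (hmulsub : ∀ m n, Fs m * Fs n ⊆ Fs (m + n))
    (hratio : Tendsto (fun n => ((Fs (n + 1)).card : ℝ) / ((Fs n).card : ℝ)) atTop (nhds 1))
    (hd1 : ∀ x y : G → A, (∃ g ∈ Fs 0, x g ≠ y g) → dist x y = 1)
    (hd2 : ∀ x y : G → A, ∀ n : ℕ, (∀ g ∈ Fs n, x g = y g) → (∃ g ∈ Fs (n + 1), x g ≠ y g) →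
      dist x y = Real.exp (-((Fs n).card : ℝ)))
    (E : Set (G → A)) :
    bowenEnt (fun (g' : G) (x : G → A) => fun g => x (g * g')) Fs E = dimH E ∧
    packEnt (fun (g' : G) (x : G → A) => fun g => x (g * g')) Fs E = packDim E := by
  have : Nontrivial A := Fintype.one_lt_card_iff_nontrivial.1 hA
  have h := isCylindrical_shift hzero (strictMono_nat_of_lt_succ hchain) hunion hmulsub hratio
    hd1 hd2
  exact ⟨h.bowenEnt_eq_dimH E, h.packEnt_eq_packDim E⟩

end AmenablePacking
end

section
/- An irregular subset of the full shift: Let A = {0,1}, let {F_n} be a tempered Følner sequence in G with F_0 = {e_G} ⊊ F_1 ⊊ F_2 ⊊ …, ⋃_n F_n = G, satisfying F_m F_n ⊆ F_{m+n} for all m,n ∈ ℕ and lim_n |F_{n+1}|/|F_n| = 1. Let 0 ≤ α < β ≤ 1 and let H ⊆ G satisfy liminf_n |H∩F_n|/|F_n| = α and limsup_n |H∩F_n|/|F_n| = β. Define X_{α,β} = {(x_g)_{g∈G} ∈ {0,1}^G : x_g = 0 if g ∉ H}. Then h^B_top(X_{α,β},{F_n}) = α·log 2 and h^P_top(X_{α,β},{F_n})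 = β·log 2; in particular X_{α,β} is not regular (its Bowen and packing entropies differ). -/
open Filter Set MeasureTheory ENNReal Topology
open scoped Pointwise symmDiff NNReal

namespace AmenablePacking

variable {G X Y : Type*}

/-- The cylinder of all configurations that agree with `x` on the finite set `F`. -/
def cylinderOn (F : Finset G) (x : G → Fin 2) : Set (G → Fin 2) :=
  {y | ∀ g ∈ F, y g = x g}

theorem disjoint_cylinderOn {F : Finset G} {x y : G → Fin 2}
    (h : F.restrict x ≠ F.restrict y) : Disjoint (cylinderOn F x) (cylinderOn F y) := by
  refine Set.disjoint_left.2 fun z hx hy => h ?_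
  funext g
  exact (hx g g.2).symm.trans (hy g g.2)

theorem cylinderOn_eq_pi (F : Finset G) (x : G → Fin 2) :
    cylinderOn F x = Set.pi F fun g => {x g} := by
  ext y
  simp [cylinderOn, Set.mem_pi]

theorem measurableSet_cylinderOn (F : Finset G) (x : G → Fin 2) :
    MeasurableSet (cylinderOn F x) := by
  rw [cylinderOn_eq_pi]
  exact MeasurableSet.pi F.countable_toSet fun g _ => measurableSet_singleton _

/-- Every set of configurations is covered by finitely many pairwise disjoint cylinders over `F`
centered in it. -/
theorem exists_finset_cylinderOn_cover (F : Finset G) (E : Set (G → Fin 2)) :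
    ∃ C : Finset (G → Fin 2), ↑C ⊆ E ∧ (E ⊆ ⋃ x ∈ C, cylinderOn F x) ∧
      (C : Set (G → Fin 2)).PairwiseDisjoint (cylinderOn F) := by
  obtain ⟨C, hCE, hC⟩ := Set.exists_subset_bijOn E F.restrict
  have hfin : C.Finite := Set.Finite.of_finite_image (Set.toFinite _) hC.injOn
  lift C to Finset (G → Fin 2) using hfin
  refine ⟨C, hCE, fun y hy => ?_, fun x hx y hy hxy => ?_⟩
  · obtain ⟨x, hx, hxy⟩ := hC.surjOn (Set.mem_image_of_mem _ hy)
    simp only [Set.mem_iUnion]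
    exact ⟨x, hx, fun g hg => (congrFun hxy ⟨g, hg⟩).symm⟩
  · exact disjoint_cylinderOn fun h => hxy (hC.injOn hx hy h)

open Classical in
/-- The law of a coordinate: a fair coin on `H`, and constantly `0` off `H`. -/
noncomputable def coinPMF (H : Set G) (g : G) : PMF (Fin 2) :=
  if g ∈ H then PMF.uniformOfFintype (Fin 2) else PMF.pure 0

/-- The law of independent fair coins on `H`, extended by `0` off `H`. -/
noncomputable def coinMeasure (H : Set G) : Measure (G → Fin 2) :=
  Measure.infinitePi fun g => (coinPMF H g).toMeasure

instance (H : Set G) : IsProbabilityMeasure (coinMeasure H) := by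
  unfold coinMeasure
  infer_instance

theorem inv_two_pow_eq_ofReal_exp (k : ℕ) :
    (2⁻¹ : ℝ≥0∞) ^ k = ENNReal.ofReal (Real.exp (-(k * Real.log 2))) := by
  rw [← mul_neg, Real.exp_nat_mul, Real.exp_neg, Real.exp_log two_pos,
    ENNReal.ofReal_pow (by norm_num), ENNReal.ofReal_inv_of_pos two_pos]
  norm_num

open Classical in
theorem prod_ite_mem_inv_two (H : Set G) (F : Finset G) :
    ∏ g ∈ F, (if g ∈ H then (2⁻¹ : ℝ≥0∞) else 1) =
      ENNReal.ofReal (Real.exp (-((H ∩ (F : Set G)).ncard * Real.log 2))) := by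
  have : (H ∩ (F : Set G)).ncard = (F.filter (· ∈ H)).card := by
    rw [← Set.ncard_coe_finset]
    congr 1
    ext g
    simp [and_comm]
  rw [Finset.prod_ite, Finset.prod_const, Finset.prod_const_one, mul_one, this,
    inv_two_pow_eq_ofReal_exp]

theorem coinMeasure_cylinderOn_le (H : Set G) (F : Finset G) (x : G → Fin 2) :
    coinMeasure H (cylinderOn F x) ≤
      ENNReal.ofReal (Real.exp (-((H ∩ (F : Set G)).ncard * Real.log 2))) := by
  classical
  rw [cylinderOn_eq_pi, coinMeasure, Measure.infinitePi_pi _ fun g _ => measurableSet_singleton _,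
    ← prod_ite_mem_inv_two]
  refine Finset.prod_le_prod' fun g _ => ?_
  split_ifs with hg
  · simp [coinPMF, hg]
  · exact prob_le_one

theorem coinMeasure_cylinderOn {H : Set G} (F : Finset G) {x : G → Fin 2}
    (hx : ∀ g ∉ H, x g = 0) :
    coinMeasure H (cylinderOn F x) =
      ENNReal.ofReal (Real.exp (-((H ∩ (F : Set G)).ncard * Real.log 2))) := by
  classical
  rw [cylinderOn_eq_pi, coinMeasure, Measure.infinitePi_pi _ fun g _ => measurableSet_singleton _,
    ← prod_ite_mem_inv_two]
  refine Finset.prod_congr rfl fun g _ => ?_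
  split_ifs with hg
  · simp [coinPMF, hg]
  · simp [coinPMF, hg, hx g hg]

theorem card_mul_le_one_of_disjoint_cylinderOn {H : Set G} {F : Finset G} {C : Finset (G → Fin 2)}
    (hCH : ↑C ⊆ {x : G → Fin 2 | ∀ g ∉ H, x g = 0})
    (hC : (C : Set (G → Fin 2)).PairwiseDisjoint (cylinderOn F)) :
    C.card * ENNReal.ofReal (Real.exp (-((H ∩ (F : Set G)).ncard * Real.log 2))) ≤ 1 := by
  rw [← nsmul_eq_mul, ← Finset.sum_const,
    ← Finset.sum_congr rfl fun x hx => coinMeasure_cylinderOn F (hCH hx),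
    ← measure_biUnion_finset hC fun x _ => measurableSet_cylinderOn F x]
  exact prob_le_one

theorem coinMeasure_vanishing_off [Countable G] (H : Set G) :
    coinMeasure H {x | ∀ g ∉ H, x g = 0} = 1 := by
  have hae : ∀ᵐ x ∂coinMeasure H, ∀ g ∉ H, x g = 0 := by
    refine ae_all_iff.2 fun g => ?_
    by_cases hg : g ∈ H
    · simp [hg]
    · have h1 : coinMeasure H (cylinderOn {g} 0) = 1 := by
        rw [coinMeasure_cylinderOn {g} (x := 0) fun _ _ => rfl]
        simp [hg]
      have h2 := (prob_compl_eq_zero_iff (measurableSet_cylinderOn {g} 0)).2 h1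
      filter_upwards [measure_eq_zero_iff_ae_notMem.1 h2] with x hx _
      simpa [cylinderOn] using hx
  have h := measure_univ (μ := coinMeasure H)
  rw [← h]
  exact measure_congr (eventuallyEq_univ.2 hae)

theorem dynClosedBall_subset_dynBall_one [PseudoMetricSpace X] (act : G → X → X)
    (F : Finset G) (x : X) {ε : ℝ} (hε : ε < 1) :
    dynClosedBall act F x ε ⊆ dynBall act F x 1 :=
  fun _ hy g hg => (hy g hg).trans_lt hε

theorem exists_enum_finset (C : Finset X) (x₀ : X) :
    ∃ f : ℕ → X, Set.BijOn f (Set.Iio C.card) C := by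
  refine ⟨fun i => if h : i < C.card then C.equivFin.symm ⟨i, h⟩ else x₀, ?_, ?_, ?_⟩
  · intro i hi
    simp [Set.mem_Iio.1 hi]
  · intro i hi j hj hij
    simp only [Set.mem_Iio.1 hi, Set.mem_Iio.1 hj, dite_true] at hij
    simpa using hij
  · intro x hx
    refine ⟨C.equivFin ⟨x, hx⟩, (C.equivFin ⟨x, hx⟩).2, ?_⟩
    simp

theorem tsum_Iio_const (k : ℕ) (a : ℝ≥0∞) : ∑' _ : Set.Iio k, a = k * a := by
  simp [tsum_fintype]

theorem bowenM_le_card_mul [PseudoMetricSpace X] (act : G → X → X) (Fs : ℕ → Finset G)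
    {Z : Set X} {N n : ℕ} {ε s : ℝ} (hn : N ≤ n) (C : Finset X) (x₀ : X)
    (hC : Z ⊆ ⋃ x ∈ C, dynBall act (Fs n) x ε) :
    bowenM act Fs Z N ε s ≤ C.card * ENNReal.ofReal (Real.exp (-s * (Fs n).card)) := by
  obtain ⟨f, hf⟩ := exists_enum_finset C x₀
  rw [← tsum_Iio_const]
  refine iInf_le_of_le (Set.Iio C.card) <| iInf_le_of_le (fun i => (f i, n)) <|
    iInf_le_of_le (fun _ _ => hn) <| iInf_le_of_le (fun z hz => ?_) le_rfl
  obtain ⟨x, hx, hzx⟩ := Set.mem_iUnion₂.1 (hC hz)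
  obtain ⟨i, hi, rfl⟩ := hf.surjOn hx
  exact Set.mem_iUnion₂.2 ⟨i, hi, hzx⟩

theorem card_mul_le_packP [PseudoMetricSpace X] (act : G → X → X) (Fs : ℕ → Finset G)
    {Z : Set X} {N n : ℕ} {ε s : ℝ} (hn : N ≤ n) (C : Finset X) (x₀ : X) (hCZ : ↑C ⊆ Z)
    (hC : (C : Set X).PairwiseDisjoint fun x => dynClosedBall act (Fs n) x ε) :
    C.card * ENNReal.ofReal (Real.exp (-s * (Fs n).card)) ≤ packP act Fs Z N ε s := by
  obtain ⟨f, hf⟩ := exists_enum_finset C x₀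
  rw [← tsum_Iio_const]
  exact le_iSup_of_le (Set.Iio C.card) <| le_iSup_of_le (fun i => (f i, n)) <|
    le_iSup_of_le (fun i hi => ⟨hCZ (hf.mapsTo hi), hn⟩) <|
    le_iSup_of_le (fun i hi j hj hij => hC (hf.mapsTo hi) (hf.mapsTo hj)
      fun h => hij (hf.injOn hi hj h)) le_rfl

/-- The mass distribution principle for the Bowen pre-measure. -/
theorem measure_le_bowenM [PseudoMetricSpace X] [MeasurableSpace X] (μ : Measure X)
    (act : G → X → X) (Fs : ℕ → Finset G) (Z : Set X) {N : ℕ} {ε s : ℝ}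
    (hμ : ∀ x, ∀ n ≥ N, μ (dynBall act (Fs n) x ε) ≤
      ENNReal.ofReal (Real.exp (-s * (Fs n).card))) :
    μ Z ≤ bowenM act Fs Z N ε s := by
  refine le_iInf fun t => le_iInf fun c => le_iInf fun hc => le_iInf fun hZ => ?_
  calc μ Z ≤ μ (⋃ i ∈ t, dynBall act (Fs (c i).2) (c i).1 ε) := measure_mono hZ
    _ ≤ ∑' i : t, μ (dynBall act (Fs (c i).2) (c i).1 ε) :=
        measure_biUnion_le μ t.to_countable _
    _ ≤ _ := ENNReal.tsum_le_tsum fun i => hμ _ _ (hc i i.2)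

theorem packPLim_empty [PseudoMetricSpace X] (act : G → X → X) (Fs : ℕ → Finset G) (ε s : ℝ) :
    packPLim act Fs ∅ ε s = 0 := by
  refine le_antisymm (iInf_le_of_le 0 ?_) zero_le
  refine iSup_le fun t => iSup_le fun c => iSup_le fun hc => iSup_le fun _ => ?_
  have : IsEmpty t := ⟨fun i => (hc i i.2).1⟩
  simp

theorem packOuter_le_packPLim [PseudoMetricSpace X] (act : G → X → X) (Fs : ℕ → Finset G)
    (Z : Set X) (ε s : ℝ) : packOuter act Fs Z ε s ≤ packPLim act Fs Z ε s := by
  refine iInf₂_le_of_le (fun i => if i = 0 then Z else ∅)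
    (Set.subset_iUnion_of_subset 0 (by simp)) ?_
  rw [tsum_eq_single 0 fun i hi => by simp [hi, packPLim_empty]]
  simp

theorem tendsto_card_atTop_of_ssubset {Fs : ℕ → Finset G} (hchain : ∀ n, Fs n ⊂ Fs (n + 1)) :
    Tendsto (fun n => ((Fs n).card : ℝ)) atTop atTop :=
  tendsto_natCast_atTop_atTop.comp
    (strictMono_nat_of_lt_succ fun n => Finset.card_lt_card (hchain n)).tendsto_atTop

theorem tendsto_card_add_div_card {Fs : ℕ → Finset G} (hne : ∀ n, (Fs n).Nonempty)
    (hratio : Tendsto (fun n => ((Fs (n + 1)).card : ℝ) / ((Fs n).card : ℝ)) atTop (nhds 1))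
    (m : ℕ) : Tendsto (fun n => ((Fs (m + n)).card : ℝ) / ((Fs n).card : ℝ)) atTop (nhds 1) := by
  have hpos : ∀ n, ((Fs n).card : ℝ) ≠ 0 := fun n => by simpa using (hne n).ne_empty
  induction m with
  | zero => simp [hpos]
  | succ m ih =>
    have h := (hratio.comp (tendsto_add_atTop_nat m)).mul ih
    rw [one_mul] at h
    refine h.congr fun n => ?_
    have h1 := hpos n
    have h2 := hpos (m + n)
    simp only [Function.comp_apply, add_comm n m, add_right_comm m 1 n]
    field_simp

/-- Along a sequence with `|F_{m+n}| / |F_n| → 1`, a rate `a < b` per element of `F_{m+n}` is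
eventually at most a rate `b` per element of `F_n`. -/
theorem eventually_mul_card_add_le {Fs : ℕ → Finset G} (hne : ∀ n, (Fs n).Nonempty)
    (hratio : Tendsto (fun n => ((Fs (n + 1)).card : ℝ) / ((Fs n).card : ℝ)) atTop (nhds 1))
    (m : ℕ) {a b : ℝ} (hab : a < b) :
    ∀ᶠ n in atTop, a * (Fs (m + n)).card ≤ b * (Fs n).card := by
  have h := (tendsto_card_add_div_card hne hratio m).const_mul a
  rw [mul_one] at h
  filter_upwards [h.eventually_lt_const hab] with n hn
  have hpos : (0 : ℝ) < (Fs n).card := by exact_mod_cast (hne n).card_pos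
  rw [← mul_div_assoc, div_lt_iff₀ hpos] at hn
  exact hn.le

theorem eventually_ofReal_exp_card_le {Fs : ℕ → Finset G} (hchain : ∀ n, Fs n ⊂ Fs (n + 1))
    {r : ℝ} (hr : 0 < r) {δ : ℝ≥0∞} (hδ : 0 < δ) :
    ∀ᶠ n in atTop, ENNReal.ofReal (Real.exp (-r * (Fs n).card)) ≤ δ := by
  have h : Tendsto (fun n => ENNReal.ofReal (Real.exp (-r * (Fs n).card))) atTop (nhds 0) := by
    rw [← ENNReal.ofReal_zero]
    refine (ENNReal.continuous_ofReal.tendsto 0).comp (Real.tendsto_exp_atBot.comp ?_)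
    exact (tendsto_card_atTop_of_ssubset hchain).const_mul_atTop_of_neg (by linarith)
  exact h.eventually_le_const hδ

section Shift

variable [MetricSpace (G → Fin 2)] {Fs : ℕ → Finset G}

theorem dist_le_of_agree (hchain : ∀ n, Fs n ⊂ Fs (n + 1)) (hunion : ∀ g : G, ∃ n, g ∈ Fs n)
    (hd2 : ∀ x y : G → Fin 2, ∀ n : ℕ, (∀ g ∈ Fs n, x g = y g) →
      (∃ g ∈ Fs (n + 1), x g ≠ y g) → dist x y = Real.exp (-((Fs n).card : ℝ)))
    {x y : G → Fin 2} {m : ℕ} (h : ∀ g ∈ Fs m, x g = y g) :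
    dist x y ≤ Real.exp (-((Fs m).card : ℝ)) := by
  classical
  by_cases hxy : x = y
  · rw [hxy, dist_self]
    positivity
  have hmono : Monotone Fs := monotone_nat_of_le_succ fun n => (hchain n).1
  obtain ⟨g, hg⟩ := Function.ne_iff.1 hxy
  have hex : ∃ k, ∃ g ∈ Fs k, x g ≠ y g := (hunion g).imp fun n hn => ⟨g, hn, hg⟩
  have hmk : m < Nat.find hex := by
    rw [Nat.lt_find_iff]
    rintro k hk ⟨g, hgk, hne⟩
    exact hne (h g (hmono hk hgk))
  obtain ⟨j, hj⟩ := Nat.exists_eq_succ_of_ne_zero (Nat.ne_zero_of_lt hmk)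
  have hagree : ∀ g ∈ Fs j, x g = y g := by
    have := Nat.find_min hex (m := j) (by omega)
    push Not at this
    exact this
  rw [hd2 x y j hagree (by simpa [hj] using Nat.find_spec hex)]
  have : (Fs m).card ≤ (Fs j).card := Finset.card_le_card (hmono (by omega))
  gcongr

theorem dynBall_one_subset_cylinderOn [Group G] (hzero : Fs 0 = {(1 : G)})
    (hd1 : ∀ x y : G → Fin 2, (∃ g ∈ Fs 0, x g ≠ y g) → dist x y = 1) (F : Finset G)
    (x : G → Fin 2) :
    dynBall (fun (g' : G) (x : G → Fin 2) => fun g => x (g * g')) F x 1 ⊆ cylinderOn F x := by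
  intro y hy g hg
  by_contra hne
  refine (hy g hg).ne (hd1 _ _ ⟨1, by simp [hzero], ?_⟩)
  simpa using Ne.symm hne

theorem exists_cylinderOn_subset_dynBall [Group G] [DecidableEq G]
    (hchain : ∀ n, Fs n ⊂ Fs (n + 1)) (hunion : ∀ g : G, ∃ n, g ∈ Fs n)
    (hmulsub : ∀ m n, Fs m * Fs n ⊆ Fs (m + n))
    (hd2 : ∀ x y : G → Fin 2, ∀ n : ℕ, (∀ g ∈ Fs n, x g = y g) →
      (∃ g ∈ Fs (n + 1), x g ≠ y g) → dist x y = Real.exp (-((Fs n).card : ℝ)))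
    {ε : ℝ} (hε : 0 < ε) :
    ∃ m, ∀ n x, cylinderOn (Fs (m + n)) x ⊆
      dynBall (fun (g' : G) (x : G → Fin 2) => fun g => x (g * g')) (Fs n) x ε := by
  have hlim : Tendsto (fun n => Real.exp (-((Fs n).card : ℝ))) atTop (nhds 0) :=
    Real.tendsto_exp_neg_atTop_nhds_zero.comp (tendsto_card_atTop_of_ssubset hchain)
  obtain ⟨m, hm⟩ := (hlim.eventually_lt_const hε).exists
  refine ⟨m, fun n x y hy g' hg' => lt_of_le_of_lt ?_ hm⟩
  exact dist_le_of_agree hchain hunion hd2 fun g hg =>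
    (hy _ (hmulsub m n (Finset.mul_mem_mul hg hg'))).symm

end Shift

theorem density_mem_Icc (H : Set G) (F : Finset G) :
    ((H ∩ (F : Set G)).ncard : ℝ) / (F.card : ℝ) ∈ Set.Icc (0 : ℝ) 1 := by
  refine ⟨by positivity, div_le_one_of_le₀ ?_ (by positivity)⟩
  rw [← Set.ncard_coe_finset]
  exact_mod_cast Set.ncard_le_ncard Set.inter_subset_right F.finite_toSet

theorem isBoundedUnder_density (H : Set G) (Fs : ℕ → Finset G) :
    IsBoundedUnder (· ≤ ·) atTop
      fun n => ((H ∩ (Fs n : Set G)).ncard : ℝ) / ((Fs n).card : ℝ) :=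
  isBoundedUnder_of ⟨1, fun n => (density_mem_Icc H (Fs n)).2⟩

theorem isBoundedUnder_ge_density (H : Set G) (Fs : ℕ → Finset G) :
    IsBoundedUnder (· ≥ ·) atTop
      fun n => ((H ∩ (Fs n : Set G)).ncard : ℝ) / ((Fs n).card : ℝ) :=
  isBoundedUnder_of ⟨0, fun n => (density_mem_Icc H (Fs n)).1⟩

section Entropy

variable [PseudoMetricSpace X] {act : G → X → X} {Fs : ℕ → Finset G} {Z : Set X} {h : ℝ}

theorem le_ofReal_of_forall_nnreal {a : ℝ≥0∞} (hh : 0 ≤ h)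
    (H : ∀ s : ℝ≥0, h < s → a ≤ s) : a ≤ ENNReal.ofReal h := by
  refine le_of_forall_gt fun b hb => ?_
  obtain ⟨s, hs, hsb⟩ := ENNReal.lt_iff_exists_nnreal_btwn.1 hb
  refine (H s ?_).trans_lt hsb
  rwa [← ENNReal.ofReal_coe_nnreal, ENNReal.ofReal_lt_ofReal_iff_of_nonneg hh] at hs

theorem bowenEnt_le (hh : 0 ≤ h)
    (H : ∀ s : ℝ≥0, h < s → ∀ ε > 0, ∀ N, bowenM act Fs Z N ε s = 0) :
    bowenEnt act Fs Z ≤ ENNReal.ofReal h := by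
  refine le_ofReal_of_forall_nnreal hh fun s hs => iInf₂_le s ?_
  simp only [bowenMLim, ENNReal.iSup_eq_zero]
  exact H s hs

theorem le_bowenEnt (H : ∀ s : ℝ≥0, (s : ℝ) < h → ∃ ε > 0, ∃ N, bowenM act Fs Z N ε s ≠ 0) :
    ENNReal.ofReal h ≤ bowenEnt act Fs Z := by
  refine le_iInf₂ fun s hs => ?_
  refine (ENNReal.ofReal_le_ofReal (le_of_not_gt fun hlt => ?_)).trans_eq
    ENNReal.ofReal_coe_nnreal
  obtain ⟨ε, hε, N, hN⟩ := H s hlt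
  simp only [bowenMLim, ENNReal.iSup_eq_zero] at hs
  exact hN (hs ε hε N)

theorem packEnt_le (hh : 0 ≤ h)
    (H : ∀ s : ℝ≥0, h < s → ∀ ε > 0, packOuter act Fs Z ε s = 0) :
    packEnt act Fs Z ≤ ENNReal.ofReal h :=
  iSup₂_le fun ε hε => le_ofReal_of_forall_nnreal hh fun s hs => iInf₂_le s (H s hs ε hε)

theorem le_packEnt {ε : ℝ} (hε : 0 < ε)
    (H : ∀ s : ℝ≥0, (s : ℝ) < h → packOuter act Fs Z ε s ≠ 0) :
    ENNReal.ofReal h ≤ packEnt act Fs Z := by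
  refine le_iSup₂_of_le ε hε (le_iInf₂ fun s hs => ?_)
  refine (ENNReal.ofReal_le_ofReal (le_of_not_gt fun hlt => ?_)).trans_eq
    ENNReal.ofReal_coe_nnreal
  exact H s hlt hs

end Entropy

section FullShift

variable [MetricSpace (G → Fin 2)] {act : G → (G → Fin 2) → G → Fin 2} {Fs : ℕ → Finset G}
  {H : Set G}

theorem bowenM_eq_zero_of_liminf_lt (hne : ∀ n, (Fs n).Nonempty)
    (hchain : ∀ n, Fs n ⊂ Fs (n + 1))
    (hratio : Tendsto (fun n => ((Fs (n + 1)).card : ℝ) / ((Fs n).card : ℝ)) atTop (nhds 1))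
    {m : ℕ} {ε s : ℝ} (hball : ∀ n x, cylinderOn (Fs (m + n)) x ⊆ dynBall act (Fs n) x ε)
    (hs : liminf (fun n => ((H ∩ (Fs n : Set G)).ncard : ℝ) / ((Fs n).card : ℝ)) atTop *
      Real.log 2 < s) (N : ℕ) :
    bowenM act Fs {x : G → Fin 2 | ∀ g ∉ H, x g = 0} N ε s = 0 := by
  have hlog : 0 < Real.log 2 := Real.log_pos one_lt_two
  obtain ⟨b, hb, hbs⟩ := exists_between hs
  obtain ⟨a, ha, hab⟩ := exists_between ((lt_div_iff₀ hlog).2 hb)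
  rw [lt_div_iff₀ hlog] at hab
  have hfreq := frequently_lt_of_liminf_lt
    (isBoundedUnder_density H Fs).isCoboundedUnder_ge ha
  refine le_antisymm (le_of_forall_gt_imp_ge_of_dense fun δ hδ => ?_) zero_le
  have hev := ((eventually_mul_card_add_le hne hratio m hab).and
    (eventually_ofReal_exp_card_le hchain (sub_pos.2 hbs) hδ)).and (eventually_ge_atTop N)
  rw [← map_add_atTop_eq_nat m, frequently_map] at hfreq
  obtain ⟨n, hn, ⟨hcard, hexp⟩, hNn⟩ := (hfreq.and_eventually hev).exists
  rw [add_comm n m] at hn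
  obtain ⟨C, hCH, hcov, hdisj⟩ := exists_finset_cylinderOn_cover (Fs (m + n))
    {x : G → Fin 2 | ∀ g ∉ H, x g = 0}
  have hpos : (0 : ℝ) < (Fs (m + n)).card := by exact_mod_cast (hne _).card_pos
  rw [div_lt_iff₀ hpos] at hn
  calc bowenM act Fs {x : G → Fin 2 | ∀ g ∉ H, x g = 0} N ε s
      ≤ C.card * ENNReal.ofReal (Real.exp (-s * (Fs n).card)) :=
        bowenM_le_card_mul act Fs hNn C 0
          (hcov.trans (Set.iUnion₂_mono fun x _ => hball n x))
    _ ≤ C.card * (ENNReal.ofReal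
          (Real.exp (-((H ∩ (Fs (m + n) : Set G)).ncard * Real.log 2))) *
          ENNReal.ofReal (Real.exp (-(s - b) * (Fs n).card))) := by
        rw [← ENNReal.ofReal_mul (by positivity), ← Real.exp_add]
        gcongr
        nlinarith [mul_lt_mul_of_pos_right hn hlog]
    _ ≤ 1 * ENNReal.ofReal (Real.exp (-(s - b) * (Fs n).card)) := by
        rw [← mul_assoc]
        gcongr
        exact card_mul_le_one_of_disjoint_cylinderOn hCH hdisj
    _ ≤ δ := by rwa [one_mul]

theorem exists_bowenM_ne_zero_of_lt_liminf [Countable G] (hne : ∀ n, (Fs n).Nonempty) {ε s : ℝ}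
    (hball : ∀ F x, dynBall act F x ε ⊆ cylinderOn F x)
    (hs : s < liminf (fun n => ((H ∩ (Fs n : Set G)).ncard : ℝ) / ((Fs n).card : ℝ)) atTop *
      Real.log 2) :
    ∃ N, bowenM act Fs {x : G → Fin 2 | ∀ g ∉ H, x g = 0} N ε s ≠ 0 := by
  have hlog : 0 < Real.log 2 := Real.log_pos one_lt_two
  obtain ⟨N, hN⟩ := eventually_atTop.1 (eventually_lt_of_lt_liminf
    ((div_lt_iff₀ hlog).2 hs) (isBoundedUnder_ge_density H Fs))
  refine ⟨N, ne_of_gt (lt_of_lt_of_le ?_ (measure_le_bowenM (coinMeasure H) act Fs _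
    fun x n hn => ?_))⟩
  · rw [coinMeasure_vanishing_off]
    exact one_pos
  · refine (measure_mono (hball _ x)).trans ((coinMeasure_cylinderOn_le H _ x).trans ?_)
    have hpos : (0 : ℝ) < (Fs n).card := by exact_mod_cast (hne _).card_pos
    have := hN n hn
    rw [div_lt_div_iff₀ hlog hpos] at this
    gcongr
    linarith

theorem packPLim_eq_zero_of_limsup_lt (hne : ∀ n, (Fs n).Nonempty)
    (hchain : ∀ n, Fs n ⊂ Fs (n + 1))
    (hratio : Tendsto (fun n => ((Fs (n + 1)).card : ℝ) / ((Fs n).card : ℝ)) atTop (nhds 1))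
    {m : ℕ} {ε s : ℝ}
    (hball : ∀ n x, cylinderOn (Fs (m + n)) x ⊆ dynClosedBall act (Fs n) x ε)
    (hs : limsup (fun n => ((H ∩ (Fs n : Set G)).ncard : ℝ) / ((Fs n).card : ℝ)) atTop *
      Real.log 2 < s) :
    packPLim act Fs {x : G → Fin 2 | ∀ g ∉ H, x g = 0} ε s = 0 := by
  have hlog : 0 < Real.log 2 := Real.log_pos one_lt_two
  obtain ⟨b, hb, hbs⟩ := exists_between hs
  obtain ⟨a, ha, hab⟩ := exists_between ((lt_div_iff₀ hlog).2 hb)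
  rw [lt_div_iff₀ hlog] at hab
  have hdens := eventually_lt_of_limsup_lt ha (isBoundedUnder_density H Fs)
  refine le_antisymm (le_of_forall_gt_imp_ge_of_dense fun δ hδ => ?_) zero_le
  rw [← map_add_atTop_eq_nat m, eventually_map] at hdens
  obtain ⟨N, hN⟩ := eventually_atTop.1 (hdens.and
    ((eventually_mul_card_add_le hne hratio m hab).and
      (eventually_ofReal_exp_card_le hchain (sub_pos.2 hbs) hδ)))
  refine iInf_le_of_le N ?_
  refine iSup_le fun t => iSup_le fun c => iSup_le fun hc => iSup_le fun hdisj => ?_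
  calc ∑' i : t, ENNReal.ofReal (Real.exp (-s * (Fs (c i).2).card))
      ≤ ∑' i : t, coinMeasure H (cylinderOn (Fs (m + (c i).2)) (c i).1) * δ := by
        refine ENNReal.tsum_le_tsum fun i => ?_
        obtain ⟨hn, hcard, hexp⟩ := hN _ (hc i i.2).2
        rw [coinMeasure_cylinderOn _ (hc i i.2).1]
        refine le_trans ?_ (mul_le_mul_right hexp _)
        have hpos : (0 : ℝ) < (Fs (m + (c i).2)).card := by exact_mod_cast (hne _).card_pos
        rw [add_comm _ m, div_lt_iff₀ hpos] at hn
        rw [← ENNReal.ofReal_mul (by positivity), ← Real.exp_add]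
        gcongr
        nlinarith [mul_lt_mul_of_pos_right hn hlog]
    _ = coinMeasure H (⋃ i : t, cylinderOn (Fs (m + (c i).2)) (c i).1) * δ := by
        rw [ENNReal.tsum_mul_right, measure_iUnion _ fun i => measurableSet_cylinderOn _ _]
        exact fun i j hij => (hdisj i i.2 j j.2 (Subtype.coe_ne_coe.2 hij)).mono
          (hball _ _) (hball _ _)
    _ ≤ 1 * δ := by
        gcongr
        exact prob_le_one
    _ = δ := one_mul δ

theorem coinMeasure_le_packPLim (hne : ∀ n, (Fs n).Nonempty) {ε s : ℝ}
    (hball : ∀ F x, dynClosedBall act F x ε ⊆ cylinderOn F x)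
    (hs : s < limsup (fun n => ((H ∩ (Fs n : Set G)).ncard : ℝ) / ((Fs n).card : ℝ)) atTop *
      Real.log 2) (E : Set (G → Fin 2)) :
    coinMeasure H E ≤ packPLim act Fs E ε s := by
  have hlog : 0 < Real.log 2 := Real.log_pos one_lt_two
  have hfreq := frequently_lt_of_lt_limsup
    (isBoundedUnder_ge_density H Fs).isCoboundedUnder_le ((div_lt_iff₀ hlog).2 hs)
  refine le_iInf fun N => ?_
  obtain ⟨n, hn, hNn⟩ := (hfreq.and_eventually (eventually_ge_atTop N)).exists
  obtain ⟨C, hCE, hcov, hdisj⟩ := exists_finset_cylinderOn_cover (Fs n) E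
  have hpos : (0 : ℝ) < (Fs n).card := by exact_mod_cast (hne _).card_pos
  rw [div_lt_div_iff₀ hlog hpos] at hn
  calc coinMeasure H E ≤ ∑ x ∈ C, coinMeasure H (cylinderOn (Fs n) x) :=
        (measure_mono hcov).trans (measure_biUnion_finset_le _ _)
    _ ≤ ∑ x ∈ C, ENNReal.ofReal (Real.exp (-s * (Fs n).card)) := by
        refine Finset.sum_le_sum fun x _ => (coinMeasure_cylinderOn_le H _ x).trans ?_
        gcongr
        linarith
    _ = C.card * ENNReal.ofReal (Real.exp (-s * (Fs n).card)) := by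
        rw [Finset.sum_const, nsmul_eq_mul]
    _ ≤ packP act Fs E N ε s := card_mul_le_packP act Fs hNn C 0 hCE
        fun x hx y hy hxy => (hdisj hx hy hxy).mono (hball _ x) (hball _ y)

theorem packOuter_ne_zero_of_lt_limsup [Countable G] (hne : ∀ n, (Fs n).Nonempty) {ε s : ℝ}
    (hball : ∀ F x, dynClosedBall act F x ε ⊆ cylinderOn F x)
    (hs : s < limsup (fun n => ((H ∩ (Fs n : Set G)).ncard : ℝ) / ((Fs n).card : ℝ)) atTop *
      Real.log 2) :
    packOuter act Fs {x : G → Fin 2 | ∀ g ∉ H, x g = 0} ε s ≠ 0 := by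
  refine ne_of_gt (one_pos.trans_le ?_)
  rw [← coinMeasure_vanishing_off H]
  refine le_iInf₂ fun Zs hZ => ((measure_mono hZ).trans (measure_iUnion_le Zs)).trans ?_
  exact ENNReal.tsum_le_tsum fun i => coinMeasure_le_packPLim hne hball hs (Zs i)

end FullShift

/-- An irregular subset of the full shift `{0,1}^G`: if `H ⊆ G` has lower density `α` and
upper density `β` along `{F_n}` (with `0 ≤ α < β ≤ 1`), then the set `X_{α,β}` of
configurations vanishing off `H` has Bowen entropy `α log 2` and packing entropy `β log 2`;
in particular it is not regular. -/
theorem irregular_subset_of_full_shift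
    {G : Type*} [Group G] [Countable G] [Infinite G] [DecidableEq G]
    [MetricSpace (G → Fin 2)]
    (Fs : ℕ → Finset G) (hFol : Folner Fs) (htemp : Tempered Fs)
    (hzero : Fs 0 = {(1 : G)})
    (hchain : ∀ n, Fs n ⊂ Fs (n + 1))
    (hunion : ∀ g : G, ∃ n, g ∈ Fs n)
    (hmulsub : ∀ m n, Fs m * Fs n ⊆ Fs (m + n))
    (hratio : Tendsto (fun n => ((Fs (n + 1)).card : ℝ) / ((Fs n).card : ℝ)) atTop (nhds 1))
    (hd1 : ∀ x y : G → Fin 2, (∃ g ∈ Fs 0, x g ≠ y g) → dist x y = 1)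
    (hd2 : ∀ x y : G → Fin 2, ∀ n : ℕ, (∀ g ∈ Fs n, x g = y g) →
      (∃ g ∈ Fs (n + 1), x g ≠ y g) → dist x y = Real.exp (-((Fs n).card : ℝ)))
    (α β : ℝ) (hα : 0 ≤ α) (hαβ : α < β) (hβ : β ≤ 1)
    (H : Set G)
    (hlower : liminf (fun n => ((H ∩ (Fs n : Set G)).ncard : ℝ) / ((Fs n).card : ℝ)) atTop = α)
    (hupper : limsup (fun n => ((H ∩ (Fs n : Set G)).ncard : ℝ) / ((Fs n).card : ℝ)) atTop = β) :
    bowenEnt (fun (g' : G) (x : G → Fin 2) => fun g => x (g * g')) Fs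
        {x : G → Fin 2 | ∀ g ∉ H, x g = 0} = ENNReal.ofReal (α * Real.log 2) ∧
    packEnt (fun (g' : G) (x : G → Fin 2) => fun g => x (g * g')) Fs
        {x : G → Fin 2 | ∀ g ∉ H, x g = 0} = ENNReal.ofReal (β * Real.log 2) ∧
    bowenEnt (fun (g' : G) (x : G → Fin 2) => fun g => x (g * g')) Fs
        {x : G → Fin 2 | ∀ g ∉ H, x g = 0} ≠
      packEnt (fun (g' : G) (x : G → Fin 2) => fun g => x (g * g')) Fs
        {x : G → Fin 2 | ∀ g ∉ H, x g = 0} := by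
  have hlog : 0 < Real.log 2 := Real.log_pos one_lt_two
  have hβ0 : 0 < β := hα.trans_lt hαβ
  have hone := dynBall_one_subset_cylinderOn hzero hd1
  have hcyl {ε : ℝ} (hε : 0 < ε) :=
    exists_cylinderOn_subset_dynBall hchain hunion hmulsub hd2 hε
  have hB : bowenEnt (fun (g' : G) (x : G → Fin 2) => fun g => x (g * g')) Fs
      {x : G → Fin 2 | ∀ g ∉ H, x g = 0} = ENNReal.ofReal (α * Real.log 2) := by
    refine le_antisymm (bowenEnt_le (by positivity) fun s hs ε hε N => ?_)
      (le_bowenEnt fun s hs => ⟨1, one_pos, ?_⟩)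
    · obtain ⟨m, hm⟩ := hcyl hε
      exact bowenM_eq_zero_of_liminf_lt hFol.1 hchain hratio hm (by rwa [hlower]) N
    · exact exists_bowenM_ne_zero_of_lt_liminf hFol.1 hone (by rwa [hlower])
  have hP : packEnt (fun (g' : G) (x : G → Fin 2) => fun g => x (g * g')) Fs
      {x : G → Fin 2 | ∀ g ∉ H, x g = 0} = ENNReal.ofReal (β * Real.log 2) := by
    refine le_antisymm (packEnt_le (by positivity) fun s hs ε hε => ?_)
      (le_packEnt one_half_pos fun s hs => ?_)
    · obtain ⟨m, hm⟩ := hcyl hε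
      refine le_antisymm ((packOuter_le_packPLim _ _ _ _ _).trans_eq ?_) zero_le
      exact packPLim_eq_zero_of_limsup_lt hFol.1 hchain hratio
        (fun n x y hy g hg => (hm n x hy g hg).le) (by rwa [hupper])
    · exact packOuter_ne_zero_of_lt_limsup hFol.1
        (fun F x => (dynClosedBall_subset_dynBall_one _ F x one_half_lt_one).trans (hone F x))
        (by rwa [hupper])
  refine ⟨hB, hP, ?_⟩
  rw [hB, hP]
  exact ((ENNReal.ofReal_lt_ofReal_iff (by positivity)).2
    (mul_lt_mul_of_pos_right hαβ hlog)).ne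

end AmenablePacking
end

section
/- Dimensional entropies of fibers of the topological {T,T⁻¹} transformation: Let A = {1,−1}, T the shift on A^ℤ, and S the {T,T⁻¹} transformation on A^ℤ×A^ℤ, so that S^n(x,y) = (T^{ω(y,n)}x, T^n y) where ω(y,n) = Σ_{j=0}^{n−1} y_j for n > 0, ω(y,0) = 0, ω(y,n) = −Σ_{j=n}^{−1} y_j for n < 0. For n > 0 let M(y,n) = max_{0≤i≤n} ω(y,i) and m(y,n) = min_{0≤i≤n} ω(y,i). For y ∈ A^ℤ let E_y = A^ℤ×{y}. Then, with respect to the Følner sequence F_n = {0,1,…,n−1} of ℤ: (1) h^P_top(E_y,S) = limsup_n (M(y,n)−m(y,n))/n · h_top(A^ℤ,T), and (2) h^B_top(E_y,S) = liminf_n (M(y,n)−m(y,n))/n · h_top(A^ℤ,T), where h_top(A^ℤ,T) = log 2. Consequently E_y is regular (equal Bowen and packing entropies) if and only if lim_n (M(y,n)−m(y,n))/n exists. -/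
open Filter Set Topology
open scoped ENNReal NNReal

namespace TTsystem

/-- The two-letter alphabet `A = {1, -1}` (as a subtype of `ℤ`). -/
abbrev Am : Type := {m : ℤ // m = 1 ∨ m = -1}

/-- The shift `T` on `A^ℤ`: `(T x)_i = x_{i+1}`. -/
def shiftT (x : ℤ → Am) : ℤ → Am := fun i => x (i + 1)

/-- The inverse shift `T⁻¹` on `A^ℤ`: `(T⁻¹ x)_i = x_{i-1}`. -/
def shiftTinv (x : ℤ → Am) : ℤ → Am := fun i => x (i - 1)

/-- The `{T, T⁻¹}` transformation `S` on `A^ℤ × A^ℤ`: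
`S(x,y) = (T x, T y)` if `y₀ = 1` and `S(x,y) = (T⁻¹ x, T y)` if `y₀ = -1`. -/
def TT : (ℤ → Am) × (ℤ → Am) → (ℤ → Am) × (ℤ → Am) :=
  fun p => if ((p.2 0 : ℤ) = 1) then (shiftT p.1, shiftT p.2) else (shiftTinv p.1, shiftT p.2)

/-- `ω(y, n) = ∑_{j=0}^{n-1} y_j` (for `n ≥ 0`). -/
def omegaSum (y : ℤ → Am) (n : ℕ) : ℤ := ∑ j ∈ Finset.range n, ((y (j : ℤ)) : ℤ)

/-- `M(y, n) = max_{0 ≤ i ≤ n} ω(y, i)`. -/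
noncomputable def Mmax (y : ℤ → Am) (n : ℕ) : ℤ :=
  (Finset.range (n + 1)).sup' (Finset.nonempty_range_iff.mpr n.succ_ne_zero) (omegaSum y)

/-- `m(y, n) = min_{0 ≤ i ≤ n} ω(y, i)`. -/
noncomputable def mmin (y : ℤ → Am) (n : ℕ) : ℤ :=
  (Finset.range (n + 1)).inf' (Finset.nonempty_range_iff.mpr n.succ_ne_zero) (omegaSum y)

variable {X : Type*}

/-- The open Bowen ball of length `n` (over `F = [0, n-1]`) for the ℤ-system generated by `S`. -/
def dynBallN [PseudoMetricSpace X] (S : X → X) (n : ℕ) (x : X) (ε : ℝ) : Set X :=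
  {y | ∀ i < n, dist (S^[i] x) (S^[i] y) < ε}

/-- The closed Bowen ball of length `n` for the ℤ-system generated by `S`. -/
def dynClosedBallN [PseudoMetricSpace X] (S : X → X) (n : ℕ) (x : X) (ε : ℝ) : Set X :=
  {y | ∀ i < n, dist (S^[i] x) (S^[i] y) ≤ ε}

/-- The packing pre-measure `P(Z, N, ε, s)`: the supremum of `∑ᵢ exp (- s nᵢ)` over all finite
or countable pairwise disjoint families of closed Bowen balls with centers in `Z` and lengths
`nᵢ ≥ N`. -/
noncomputable def packPN [PseudoMetricSpace X] (S : X → X) (Z : Set X) (N : ℕ) (ε s : ℝ) :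
    ℝ≥0∞ :=
  ⨆ (t : Set ℕ) (c : ℕ → X × ℕ) (_ : ∀ i ∈ t, (c i).1 ∈ Z ∧ N ≤ (c i).2)
    (_ : ∀ i ∈ t, ∀ j ∈ t, i ≠ j →
      Disjoint (dynClosedBallN S (c i).2 (c i).1 ε) (dynClosedBallN S (c j).2 (c j).1 ε)),
    ∑' i : t, ENNReal.ofReal (Real.exp (-s * ((c (i : ℕ)).2 : ℝ)))

/-- `P(Z, ε, s) = lim_{N → ∞} P(Z, N, ε, s)` (non-increasing in `N`). -/
noncomputable def packPLimN [PseudoMetricSpace X] (S : X → X) (Z : Set X) (ε s : ℝ) : ℝ≥0∞ :=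
  ⨅ N : ℕ, packPN S Z N ε s

/-- `𝒫(Z, ε, s)`: the countably subadditive envelope of `P(·, ε, s)`. -/
noncomputable def packOuterN [PseudoMetricSpace X] (S : X → X) (Z : Set X) (ε s : ℝ) : ℝ≥0∞ :=
  ⨅ (Zs : ℕ → Set X) (_ : Z ⊆ ⋃ i, Zs i), ∑' i, packPLimN S (Zs i) ε s

/-- `h^P_top(Z, ε)`: critical value of `s` for `𝒫(Z, ε, s)`. -/
noncomputable def packEntEpsN [PseudoMetricSpace X] (S : X → X) (Z : Set X) (ε : ℝ) : ℝ≥0∞ :=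
  ⨅ (s : ℝ≥0) (_ : packOuterN S Z ε (s : ℝ) = 0), (s : ℝ≥0∞)

/-- The packing topological entropy `h^P_top(Z, S) = lim_{ε → 0} h^P_top(Z, ε)`. -/
noncomputable def packEntN [PseudoMetricSpace X] (S : X → X) (Z : Set X) : ℝ≥0∞ :=
  ⨆ (ε : ℝ) (_ : 0 < ε), packEntEpsN S Z ε

/-- The Bowen pre-measure `ℳ(Z, N, ε, s)`: the infimum of `∑ᵢ exp (- s nᵢ)` over countable
covers of `Z` by open Bowen balls with lengths `nᵢ ≥ N`. -/
noncomputable def bowenMN [PseudoMetricSpace X] (S : X → X) (Z : Set X) (N : ℕ) (ε s : ℝ) :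
    ℝ≥0∞ :=
  ⨅ (t : Set ℕ) (c : ℕ → X × ℕ) (_ : ∀ i ∈ t, N ≤ (c i).2)
    (_ : Z ⊆ ⋃ i ∈ t, dynBallN S (c i).2 (c i).1 ε),
    ∑' i : t, ENNReal.ofReal (Real.exp (-s * ((c (i : ℕ)).2 : ℝ)))

/-- `ℳ(Z, s) = lim_{ε → 0} lim_{N → ∞} ℳ(Z, N, ε, s)`. -/
noncomputable def bowenMLimN [PseudoMetricSpace X] (S : X → X) (Z : Set X) (s : ℝ) : ℝ≥0∞ :=
  ⨆ (ε : ℝ) (_ : 0 < ε), ⨆ N : ℕ, bowenMN S Z N ε s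

/-- The Bowen topological entropy `h^B_top(Z, S)`. -/
noncomputable def bowenEntN [PseudoMetricSpace X] (S : X → X) (Z : Set X) : ℝ≥0∞ :=
  ⨅ (s : ℝ≥0) (_ : bowenMLimN S Z (s : ℝ) = 0), (s : ℝ≥0∞)

instance : Fintype Am := Fintype.subtype {1, -1} (by simp)

instance : Nonempty Am := ⟨⟨1, Or.inl rfl⟩⟩

theorem card_Am : Fintype.card Am = 2 := rfl

section Words

theorem TT_iterate (x y : ℤ → Am) (i : ℕ) :
    TT^[i] (x, y) = (fun j => x (j + omegaSum y i), fun j => y (j + i)) := by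
  induction i with
  | zero => simp [omegaSum]
  | succ i ih =>
    rw [Function.iterate_succ_apply', ih]
    have h1 : omegaSum y (i + 1) = omegaSum y i + (y i : ℤ) := by
      simp [omegaSum, Finset.sum_range_succ]
    rcases (y i).2 with h | h
    · simp only [TT, zero_add, h, if_true, h1, Prod.mk.injEq]
      constructor <;> funext j <;> rw [shiftT] <;> congr 1 <;> push_cast <;> ring
    · simp only [TT, zero_add, h, h1, if_neg (show ¬ (-1 : ℤ) = 1 by decide), Prod.mk.injEq]
      constructor <;> funext j
      · rw [shiftTinv]; congr 1; ring
      · rw [shiftT]; congr 1; push_cast; ring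

theorem omegaSum_congr {y y' : ℤ → Am} {n : ℕ} (h : ∀ i < n, y (i : ℕ) = y' (i : ℕ)) :
    omegaSum y n = omegaSum y' n :=
  Finset.sum_congr rfl fun i hi => by rw [h i (Finset.mem_range.mp hi)]

theorem Mmax_succ (y : ℤ → Am) (n : ℕ) :
    Mmax y (n + 1) = max (Mmax y n) (omegaSum y (n + 1)) := by
  unfold Mmax
  simp only [Finset.range_add_one (n := n + 1)]
  exact (Finset.sup'_insert (by simp) _).trans (max_comm _ _)

theorem mmin_succ (y : ℤ → Am) (n : ℕ) :
    mmin y (n + 1) = min (mmin y n) (omegaSum y (n + 1)) := by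
  unfold mmin
  simp only [Finset.range_add_one (n := n + 1)]
  exact (Finset.inf'_insert (by simp) _).trans (min_comm _ _)

theorem omegaSum_le_Mmax (y : ℤ → Am) {i n : ℕ} (h : i ≤ n) : omegaSum y i ≤ Mmax y n :=
  Finset.le_sup' (omegaSum y) (by simpa [Nat.lt_succ_iff] using h)

theorem mmin_le_omegaSum (y : ℤ → Am) {i n : ℕ} (h : i ≤ n) : mmin y n ≤ omegaSum y i :=
  Finset.inf'_le (omegaSum y) (by simpa [Nat.lt_succ_iff] using h)

theorem mmin_le_Mmax (y : ℤ → Am) (n : ℕ) : mmin y n ≤ Mmax y n :=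
  (mmin_le_omegaSum y le_rfl).trans (omegaSum_le_Mmax y le_rfl)

/-- The sites of the scenery read by the walker during the first `n` steps. -/
def visited (y : ℤ → Am) (n : ℕ) : Finset ℤ := (Finset.range n).image (omegaSum y)

theorem visited_succ (y : ℤ → Am) (n : ℕ) :
    visited y (n + 1) = Finset.Icc (mmin y n) (Mmax y n) := by
  induction n with
  | zero => ext; simp [visited, mmin, Mmax]
  | succ n ih =>
    have h1 : omegaSum y (n + 1) = omegaSum y n + (y n : ℤ) := by
      simp [omegaSum, Finset.sum_range_succ]
    have h2 := omegaSum_le_Mmax y (le_refl n)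
    have h3 := mmin_le_omegaSum y (le_refl n)
    have h4 : visited y (n + 1 + 1) = insert (omegaSum y (n + 1)) (visited y (n + 1)) := by
      simp [visited, Finset.range_add_one]
    rw [h4, ih, Mmax_succ, mmin_succ]
    ext j
    simp only [Finset.mem_insert, Finset.mem_Icc]
    rcases (y n).2 with h | h <;> rw [h] at h1 <;> omega

theorem visited_card_succ (y : ℤ → Am) (n : ℕ) :
    ((visited y (n + 1)).card : ℤ) = Mmax y n - mmin y n + 1 := by
  rw [visited_succ, Int.card_Icc, Int.toNat_of_nonneg] <;> linarith [mmin_le_Mmax y n]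

theorem le_visited_card (y : ℤ → Am) (n : ℕ) :
    Mmax y n - mmin y n ≤ (visited y n).card := by
  have h4 : visited y (n + 1) = insert (omegaSum y n) (visited y n) := by
    simp [visited, Finset.range_add_one]
  have h := visited_card_succ y n
  have h5 := Finset.card_insert_le (omegaSum y n) (visited y n)
  rw [← h4] at h5
  omega

theorem range_le (y : ℤ → Am) (n : ℕ) : Mmax y n - mmin y n ≤ n := by
  have h : (visited y (n + 1)).card ≤ n + 1 :=
    Finset.card_image_le.trans (Finset.card_range _).le
  have := visited_card_succ y n
  omega

/-- The sites within distance `k` of the range of the walk up to time `n`. -/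
noncomputable def window (y : ℤ → Am) (k n : ℕ) : Finset ℤ :=
  Finset.Icc (mmin y n - k) (Mmax y n + k)

theorem window_card (y : ℤ → Am) (k n : ℕ) :
    ((window y k n).card : ℤ) = Mmax y n - mmin y n + 2 * k + 1 := by
  have := mmin_le_Mmax y n
  rw [window, Int.card_Icc, Int.toNat_of_nonneg] <;> linarith

/-- Configurations that agree with `x` on `F`. -/
def cyl (F : Finset ℤ) (x : ℤ → Am) : Set (ℤ → Am) := {x' | ∀ j ∈ F, x' j = x j}

/-- The fair coin tossing measure on `A^ℤ`. -/
noncomputable def coin : MeasureTheory.Measure (ℤ → Am) :=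
  MeasureTheory.Measure.infinitePi fun _ => (PMF.uniformOfFintype Am).toMeasure

instance : MeasureTheory.IsProbabilityMeasure coin := by
  unfold coin; infer_instance

theorem cyl_eq_pi (F : Finset ℤ) (x : ℤ → Am) : cyl F x = Set.pi F fun j => {x j} := by
  ext; simp [cyl]

theorem measurableSet_cyl (F : Finset ℤ) (x : ℤ → Am) : MeasurableSet (cyl F x) := by
  rw [cyl_eq_pi]
  exact MeasurableSet.pi F.countable_toSet fun _ _ => measurableSet_singleton _

theorem coin_cyl (F : Finset ℤ) (x : ℤ → Am) : coin (cyl F x) = (2⁻¹ : ℝ≥0∞) ^ F.card := by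
  rw [cyl_eq_pi, coin, MeasureTheory.Measure.infinitePi_pi _ fun _ _ => measurableSet_singleton _]
  simp [card_Am]

theorem exists_two_rpow_neg_lt {ε : ℝ} (hε : 0 < ε) : ∃ k : ℕ, (2 : ℝ) ^ (-(k : ℝ)) < ε := by
  obtain ⟨k, hk⟩ := exists_pow_lt_of_lt_one hε (show (1 / 2 : ℝ) < 1 by norm_num)
  refine ⟨k, ?_⟩
  rwa [Real.rpow_neg (by norm_num), Real.rpow_natCast, ← inv_pow, ← one_div]

end Words

section Metric

/-- The distance of two distinct configurations is `2^{-n}`, where `n` is the least modulus of a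
coordinate at which they differ. -/
def IsStandard [MetricSpace (ℤ → Am)] : Prop :=
  ∀ x y : ℤ → Am, ∀ n : ℕ, (∃ i : ℤ, i.natAbs = n ∧ x i ≠ y i) →
    (∀ i : ℤ, i.natAbs < n → x i = y i) → dist x y = (2 : ℝ) ^ (-(n : ℝ))

variable [MetricSpace (ℤ → Am)]

theorem IsStandard.eq_zero (h : IsStandard) {x x' : ℤ → Am} (hd : dist x x' ≤ 1 / 2) :
    x 0 = x' 0 := by
  by_contra hne
  have := h x x' 0 ⟨0, rfl, hne⟩ (by simp)
  norm_num [this] at hd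

theorem IsStandard.dist_le (h : IsStandard) {x x' : ℤ → Am} {k : ℕ}
    (hk : ∀ i : ℤ, i.natAbs ≤ k → x i = x' i) : dist x x' ≤ (2 : ℝ) ^ (-(k : ℝ)) := by
  classical
  by_cases he : x = x'
  · rw [he, dist_self]; positivity
  · have hex : ∃ n : ℕ, ∃ i : ℤ, i.natAbs = n ∧ x i ≠ x' i := by
      obtain ⟨i, hi⟩ := Function.ne_iff.mp he
      exact ⟨_, i, rfl, hi⟩
    have hlt : k ≤ Nat.find hex := by
      obtain ⟨i, hi, hne⟩ := Nat.find_spec hex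
      by_contra hcon
      exact hne (hk i (by omega))
    rw [h x x' (Nat.find hex) (Nat.find_spec hex) fun i hi => by
      by_contra hne
      exact Nat.find_min hex hi ⟨i, rfl, hne⟩]
    exact Real.rpow_le_rpow_of_exponent_le (by norm_num) (by simpa using hlt)

theorem IsStandard.agree_of_closedBall (h : IsStandard) {x x' y y' : ℤ → Am} {n : ℕ}
    (hd : (x', y') ∈ dynClosedBallN TT n (x, y) (1 / 2)) :
    (∀ i < n, y (i : ℕ) = y' (i : ℕ)) ∧ x' ∈ cyl (visited y n) x := by
  have hd' : ∀ i < n, dist (TT^[i] (x, y)) (TT^[i] (x', y')) ≤ 1 / 2 := hd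
  have hy : ∀ i < n, y (i : ℕ) = y' (i : ℕ) := fun i hi => by
    have := hd' i hi
    rw [TT_iterate, TT_iterate, Prod.dist_eq, max_le_iff] at this
    simpa using h.eq_zero this.2
  refine ⟨hy, fun j hj => ?_⟩
  obtain ⟨i, hi, rfl⟩ := Finset.mem_image.mp hj
  have hi := Finset.mem_range.mp hi
  have := hd' i hi
  rw [TT_iterate, TT_iterate, Prod.dist_eq, max_le_iff] at this
  have h1 := h.eq_zero this.1
  rw [← omegaSum_congr (y := y) (y' := y') fun l hl => hy l (hl.trans hi)] at h1
  simpa using h1.symm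

theorem IsStandard.dist_iterate_le (h : IsStandard) {x x' y : ℤ → Am} {k n : ℕ}
    (hx : x' ∈ cyl (window y k n) x) {i : ℕ} (hi : i < n) :
    dist (TT^[i] (x, y)) (TT^[i] (x', y)) ≤ (2 : ℝ) ^ (-(k : ℝ)) := by
  rw [TT_iterate, TT_iterate, Prod.dist_eq, dist_self, max_eq_left dist_nonneg]
  refine h.dist_le fun j hj => (hx _ ?_).symm
  have h1 := omegaSum_le_Mmax y hi.le
  have h2 := mmin_le_omegaSum y hi.le
  rw [window, Finset.mem_Icc]
  omega

/-- The fiber `E_y`. -/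
abbrev fiber (y : ℤ → Am) : Set ((ℤ → Am) × (ℤ → Am)) := Set.univ ×ˢ {y}

end Metric

section Families

variable {X : Type*} [PseudoMetricSpace X] [Nonempty X]

theorem tsum_le_packPN {ι : Type*} [Countable ι] (S : X → X) (Z : Set X) (N : ℕ) (ε s : ℝ)
    (f : ι → X × ℕ) (hf : ∀ i, (f i).1 ∈ Z ∧ N ≤ (f i).2)
    (hd : ∀ i j, i ≠ j →
      Disjoint (dynClosedBallN S (f i).2 (f i).1 ε) (dynClosedBallN S (f j).2 (f j).1 ε)) :
    ∑' i, ENNReal.ofReal (Real.exp (-s * ((f i).2 : ℝ))) ≤ packPN S Z N ε s := by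
  obtain ⟨e, he⟩ := Countable.exists_injective_nat ι
  have hc : ∀ i, Function.extend e f (fun _ => (Classical.arbitrary X, 0)) (e i) = f i :=
    he.extend_apply f _
  refine le_iSup_of_le (Set.range e) (le_iSup_of_le
    (Function.extend e f fun _ => (Classical.arbitrary X, 0)) (le_iSup_of_le ?_
    (le_iSup_of_le ?_ ?_)))
  · rintro _ ⟨i, rfl⟩
    rw [hc]; exact hf i
  · rintro _ ⟨i, rfl⟩ _ ⟨j, rfl⟩ hij
    rw [hc, hc]; exact hd i j fun h => hij (congrArg e h)
  · rw [tsum_range (fun m => ENNReal.ofReal (Real.exp (-s *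
      ((Function.extend e f (fun _ => (Classical.arbitrary X, 0)) m).2 : ℝ)))) he]
    simp_rw [hc]
    exact le_rfl

theorem bowenMN_le_tsum {ι : Type*} [Countable ι] (S : X → X) (Z : Set X) (N : ℕ) (ε s : ℝ)
    (f : ι → X × ℕ) (hf : ∀ i, N ≤ (f i).2)
    (hd : Z ⊆ ⋃ i, dynBallN S (f i).2 (f i).1 ε) :
    bowenMN S Z N ε s ≤ ∑' i, ENNReal.ofReal (Real.exp (-s * ((f i).2 : ℝ))) := by
  obtain ⟨e, he⟩ := Countable.exists_injective_nat ι
  have hc : ∀ i, Function.extend e f (fun _ => (Classical.arbitrary X, 0)) (e i) = f i :=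
    he.extend_apply f _
  refine iInf_le_of_le (Set.range e) (iInf_le_of_le
    (Function.extend e f fun _ => (Classical.arbitrary X, 0)) (iInf_le_of_le ?_
    (iInf_le_of_le ?_ ?_)))
  · rintro _ ⟨i, rfl⟩
    rw [hc]; exact hf i
  · rw [Set.biUnion_range]
    simpa only [hc] using hd
  · rw [tsum_range (fun m => ENNReal.ofReal (Real.exp (-s *
      ((Function.extend e f (fun _ => (Classical.arbitrary X, 0)) m).2 : ℝ)))) he]
    simp_rw [hc]
    exact le_rfl

end Families

section Bounds

variable [MetricSpace (ℤ → Am)]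

theorem IsStandard.mem_dynBallN (h : IsStandard) {x x' y : ℤ → Am} {k n : ℕ} {ε : ℝ}
    (hk : (2 : ℝ) ^ (-(k : ℝ)) < ε) (hx : x' ∈ cyl (window y k n) x) :
    (x', y) ∈ dynBallN TT n (x, y) ε :=
  fun _ hi => (h.dist_iterate_le hx hi).trans_lt hk

theorem IsStandard.one_le_bowenMN (h : IsStandard) {y : ℤ → Am} {N : ℕ} {s : ℝ}
    (hN : ∀ n ≥ N, (2⁻¹ : ℝ≥0∞) ^ (visited y n).card ≤ ENNReal.ofReal (Real.exp (-s * n))) :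
    1 ≤ bowenMN TT (fiber y) N (1 / 2) s := by
  refine le_iInf fun t => le_iInf fun c => le_iInf fun hc => le_iInf fun hcov => ?_
  have hball : ∀ i ∈ t, coin {x | (x, y) ∈ dynBallN TT (c i).2 (c i).1 (1 / 2)} ≤
      ENNReal.ofReal (Real.exp (-s * ((c i).2 : ℝ))) := by
    intro i hi
    refine le_trans ?_ (hN _ (hc i hi))
    have hag : ∀ x, (x, y) ∈ dynBallN TT (c i).2 (c i).1 (1 / 2) →
        (∀ l < (c i).2, (c i).1.2 (l : ℕ) = y (l : ℕ)) ∧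
          x ∈ cyl (visited (c i).1.2 (c i).2) (c i).1.1 := fun x hx =>
      h.agree_of_closedBall (x := (c i).1.1) (y := (c i).1.2) fun l hl => (hx l hl).le
    rcases Set.eq_empty_or_nonempty {x | (x, y) ∈ dynBallN TT (c i).2 (c i).1 (1 / 2)}
      with he | ⟨x₀, hx₀⟩
    · rw [he, MeasureTheory.measure_empty]; exact zero_le
    · have hv : visited (c i).1.2 (c i).2 = visited y (c i).2 :=
        Finset.image_congr fun l hl => omegaSum_congr fun m hm =>
          (hag x₀ hx₀).1 m (hm.trans (by simpa using hl))
      rw [← hv, ← coin_cyl _ (c i).1.1]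
      exact MeasureTheory.measure_mono fun x hx => (hag x hx).2
  calc (1 : ℝ≥0∞) = coin Set.univ := MeasureTheory.measure_univ.symm
    _ ≤ coin (⋃ i ∈ t, {x | (x, y) ∈ dynBallN TT (c i).2 (c i).1 (1 / 2)}) := by
      refine MeasureTheory.measure_mono fun x _ => ?_
      simpa using hcov (show (x, y) ∈ fiber y by simp)
    _ ≤ ∑' i : t, coin {x | (x, y) ∈ dynBallN TT (c i).2 (c i).1 (1 / 2)} :=
      MeasureTheory.measure_biUnion_le _ t.to_countable _
    _ ≤ _ := ENNReal.tsum_le_tsum fun i => hball i i.2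

theorem IsStandard.coin_le_packPN (h : IsStandard) {y : ℤ → Am} {N n : ℕ} {s : ℝ}
    (hn : N ≤ n) (Z : Set ((ℤ → Am) × (ℤ → Am)))
    (hs : (2⁻¹ : ℝ≥0∞) ^ (visited y n).card ≤ ENNReal.ofReal (Real.exp (-s * n))) :
    coin {x | (x, y) ∈ Z} ≤ packPN TT Z N (1 / 2) s := by
  let r : (ℤ → Am) → (visited y n → Am) := fun x j => x j
  have hz : ∀ p : r '' {x | (x, y) ∈ Z}, ∃ z, (z, y) ∈ Z ∧ r z = p := fun p => p.2
  choose z hzZ hzr using hz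
  refine le_trans ?_ (tsum_le_packPN TT Z N (1 / 2) s (fun p => ((z p, y), n))
    (fun p => ⟨hzZ p, hn⟩) ?_)
  · calc coin {x | (x, y) ∈ Z} ≤ coin (⋃ p, cyl (visited y n) (z p)) := by
          refine MeasureTheory.measure_mono fun x hx => Set.mem_iUnion.mpr ⟨⟨r x, x, hx, rfl⟩, ?_⟩
          exact fun j hj => (congrFun (hzr ⟨r x, x, hx, rfl⟩) ⟨j, hj⟩).symm
      _ ≤ ∑' p, coin (cyl (visited y n) (z p)) := MeasureTheory.measure_iUnion_le _
      _ ≤ _ := ENNReal.tsum_le_tsum fun p => by rw [coin_cyl]; exact hs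
  · intro p q hpq
    refine Set.disjoint_left.mpr fun w hw hw' => hpq ?_
    have h1 := (h.agree_of_closedBall (x' := w.1) (y' := w.2) hw).2
    have h2 := (h.agree_of_closedBall (x' := w.1) (y' := w.2) hw').2
    refine Subtype.ext ?_
    rw [← hzr p, ← hzr q]
    exact funext fun j => (h1 j j.2).symm.trans (h2 j j.2)

theorem IsStandard.one_le_packOuterN (h : IsStandard) {y : ℤ → Am} {s : ℝ}
    (hs : ∃ᶠ n : ℕ in atTop,
      (2⁻¹ : ℝ≥0∞) ^ (visited y n).card ≤ ENNReal.ofReal (Real.exp (-s * n))) :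
    1 ≤ packOuterN TT (fiber y) (1 / 2) s := by
  refine le_iInf fun Zs => le_iInf fun hcov => ?_
  calc (1 : ℝ≥0∞) = coin Set.univ := MeasureTheory.measure_univ.symm
    _ ≤ coin (⋃ i, {x | (x, y) ∈ Zs i}) := by
      refine MeasureTheory.measure_mono fun x _ => ?_
      simpa using hcov (show (x, y) ∈ fiber y by simp)
    _ ≤ ∑' i, coin {x | (x, y) ∈ Zs i} := MeasureTheory.measure_iUnion_le _
    _ ≤ _ := ENNReal.tsum_le_tsum fun i => le_iInf fun N => by
      obtain ⟨n, hn, hsn⟩ := Filter.frequently_atTop.mp hs N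
      exact h.coin_le_packPN hn _ hsn

theorem IsStandard.packPN_le (h : IsStandard) {y : ℤ → Am} {N k : ℕ} {ε s : ℝ} {B : ℝ≥0∞}
    (hk : (2 : ℝ) ^ (-(k : ℝ)) < ε)
    (hB : ∀ n ≥ N, ENNReal.ofReal (Real.exp (-s * n)) ≤ B * 2⁻¹ ^ (window y k n).card) :
    packPN TT (fiber y) N ε s ≤ B := by
  refine iSup_le fun t => iSup_le fun c => iSup_le fun hc => iSup_le fun hd => ?_
  have hcy : ∀ i ∈ t, (c i).1 = ((c i).1.1, y) := fun i hi =>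
    Prod.ext rfl (by simpa using (hc i hi).1)
  have hsub : ∀ i ∈ t, ∀ x ∈ cyl (window y k (c i).2) (c i).1.1,
      (x, y) ∈ dynClosedBallN TT (c i).2 (c i).1 ε := fun i hi x hx l hl => by
    rw [hcy i hi]
    exact (h.mem_dynBallN hk hx l hl).le
  calc ∑' i : t, ENNReal.ofReal (Real.exp (-s * ((c i).2 : ℝ)))
      ≤ ∑' i : t, B * coin (cyl (window y k (c i).2) (c i).1.1) :=
        ENNReal.tsum_le_tsum fun i => by rw [coin_cyl]; exact hB _ (hc i i.2).2
    _ = B * ∑' i : t, coin (cyl (window y k (c i).2) (c i).1.1) := ENNReal.tsum_mul_left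
    _ ≤ B * coin Set.univ := by
      gcongr
      refine MeasureTheory.tsum_measure_le_measure_univ
        (fun i => (measurableSet_cyl _ _).nullMeasurableSet) fun i j hij => ?_
      refine Disjoint.aedisjoint (Set.disjoint_left.mpr fun x hx hx' => ?_)
      exact Set.disjoint_left.mp (hd i i.2 j j.2 fun e => hij (Subtype.ext e))
        (hsub i i.2 x hx) (hsub j j.2 x hx')
    _ = B := by rw [MeasureTheory.measure_univ, mul_one]

theorem IsStandard.bowenMN_le (h : IsStandard) {y : ℤ → Am} {N n k : ℕ} {ε s : ℝ} {B : ℝ≥0∞}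
    (hk : (2 : ℝ) ^ (-(k : ℝ)) < ε) (hn : N ≤ n)
    (hB : ENNReal.ofReal (Real.exp (-s * n)) ≤ B * 2⁻¹ ^ (window y k n).card) :
    bowenMN TT (fiber y) N ε s ≤ B := by
  classical
  let z : (window y k n → Am) → (ℤ → Am) := fun p j =>
    if hj : j ∈ window y k n then p ⟨j, hj⟩ else Classical.arbitrary Am
  refine (bowenMN_le_tsum TT (fiber y) N ε s (fun p => ((z p, y), n)) (fun _ => hn) ?_).trans ?_
  · rintro ⟨x, y'⟩ hx
    obtain rfl : y' = y := by simpa using hx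
    refine Set.mem_iUnion.mpr ⟨fun j => x j, h.mem_dynBallN hk fun j hj => ?_⟩
    simp [z, hj]
  · calc ∑' _ : window y k n → Am, ENNReal.ofReal (Real.exp (-s * n))
        = 2 ^ (window y k n).card * ENNReal.ofReal (Real.exp (-s * n)) := by
          rw [tsum_fintype, Finset.sum_const, Finset.card_univ, Fintype.card_fun, card_Am,
            Fintype.card_coe, nsmul_eq_mul]
          norm_cast
      _ ≤ 2 ^ (window y k n).card * (B * 2⁻¹ ^ (window y k n).card) := by gcongr
      _ = B := by
        rw [mul_left_comm, ← mul_pow, ENNReal.mul_inv_cancel (by norm_num) (by norm_num),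
          one_pow, mul_one]

end Bounds

section Rates

theorem inv_two_pow_eq (m : ℕ) :
    (2⁻¹ : ℝ≥0∞) ^ m = ENNReal.ofReal (Real.exp (-(m * Real.log 2))) := by
  rw [Real.exp_neg, Real.exp_nat_mul, Real.exp_log (by norm_num),
    ENNReal.ofReal_inv_of_pos (by positivity), ENNReal.ofReal_pow (by norm_num), ENNReal.inv_pow]
  norm_num

theorem inv_two_pow_visited_le {y : ℤ → Am} {n : ℕ} {s : ℝ}
    (hs : s * n ≤ ((Mmax y n - mmin y n : ℤ) : ℝ) * Real.log 2) :
    (2⁻¹ : ℝ≥0∞) ^ (visited y n).card ≤ ENNReal.ofReal (Real.exp (-s * n)) := by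
  rw [inv_two_pow_eq]
  have h1 : ((Mmax y n - mmin y n : ℤ) : ℝ) ≤ ((visited y n).card : ℝ) := by
    exact_mod_cast le_visited_card y n
  have h2 := mul_le_mul_of_nonneg_right h1 (Real.log_pos one_lt_two).le
  gcongr
  linarith

theorem exp_le_mul_inv_two_pow_window (y : ℤ → Am) (k : ℕ) {s s' δ : ℝ} (hs : s' < s)
    (hδ : 0 < δ) : ∀ᶠ n : ℕ in atTop,
      ((Mmax y n - mmin y n : ℤ) : ℝ) * Real.log 2 ≤ s' * n →
      ENNReal.ofReal (Real.exp (-s * n)) ≤ ENNReal.ofReal δ * 2⁻¹ ^ (window y k n).card := by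
  have ht : Tendsto (fun n : ℕ => (s - s') * (n : ℝ)) atTop atTop :=
    tendsto_natCast_atTop_atTop.const_mul_atTop (sub_pos.mpr hs)
  filter_upwards [ht.eventually_ge_atTop ((2 * k + 1) * Real.log 2 - Real.log δ)] with n hn hD
  have hw : ((window y k n).card : ℝ) = ((Mmax y n - mmin y n : ℤ) : ℝ) + 2 * k + 1 := by
    exact_mod_cast window_card y k n
  rw [inv_two_pow_eq, ← ENNReal.ofReal_mul hδ.le]
  refine ENNReal.ofReal_le_ofReal ?_
  rw [hw]
  nth_rewrite 1 [← Real.exp_log hδ]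
  rw [← Real.exp_add, Real.exp_le_exp]
  linarith

end Rates

section Entropy

/-- The normalised range of the walk. -/
noncomputable abbrev rate (y : ℤ → Am) (n : ℕ) : ℝ := ((Mmax y n - mmin y n : ℤ) : ℝ) / (n : ℝ)

theorem rate_nonneg (y : ℤ → Am) (n : ℕ) : 0 ≤ rate y n :=
  div_nonneg (by exact_mod_cast sub_nonneg.mpr (mmin_le_Mmax y n)) n.cast_nonneg

theorem rate_le_one (y : ℤ → Am) (n : ℕ) : rate y n ≤ 1 :=
  div_le_one_of_le₀ (by exact_mod_cast range_le y n) n.cast_nonneg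

theorem isBoundedUnder_le_rate (y : ℤ → Am) : IsBoundedUnder (· ≤ ·) atTop (rate y) :=
  isBoundedUnder_of ⟨1, rate_le_one y⟩

theorem isBoundedUnder_ge_rate (y : ℤ → Am) : IsBoundedUnder (· ≥ ·) atTop (rate y) :=
  isBoundedUnder_of ⟨0, rate_nonneg y⟩

theorem liminf_rate_nonneg (y : ℤ → Am) : 0 ≤ liminf (rate y) atTop :=
  le_liminf_of_le (isBoundedUnder_le_rate y).isCoboundedUnder_ge
    (Eventually.of_forall (rate_nonneg y))

theorem limsup_rate_nonneg (y : ℤ → Am) : 0 ≤ limsup (rate y) atTop :=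
  (liminf_rate_nonneg y).trans
    (liminf_le_limsup (isBoundedUnder_le_rate y) (isBoundedUnder_ge_rate y))

theorem mul_log_le_of_rate_lt {y : ℤ → Am} {n : ℕ} {s : ℝ} (hn : 0 < n)
    (h : rate y n < s / Real.log 2) :
    ((Mmax y n - mmin y n : ℤ) : ℝ) * Real.log 2 ≤ s * n := by
  rw [rate, div_lt_div_iff₀ (by exact_mod_cast hn) (Real.log_pos one_lt_two)] at h
  exact h.le

theorem le_mul_log_of_lt_rate {y : ℤ → Am} {n : ℕ} {s : ℝ} (hn : 0 < n)
    (h : s / Real.log 2 < rate y n) :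
    s * n ≤ ((Mmax y n - mmin y n : ℤ) : ℝ) * Real.log 2 := by
  rw [rate, div_lt_div_iff₀ (Real.log_pos one_lt_two) (by exact_mod_cast hn)] at h
  exact h.le

theorem critical_eq_ofReal {a : ℝ} {p : ℝ≥0 → Prop}
    (hp : ∀ s : ℝ≥0, a < s → p s) (hn : ∀ s : ℝ≥0, (s : ℝ) < a → ¬ p s) :
    (⨅ (s : ℝ≥0) (_ : p s), (s : ℝ≥0∞)) = ENNReal.ofReal a := by
  refine le_antisymm (ENNReal.le_of_forall_pos_le_add fun δ hδ _ => ?_)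
    (le_iInf₂ fun s hs => ?_)
  · refine (iInf₂_le (a.toNNReal + δ) (hp _ ?_)).trans (by simp [ENNReal.ofReal])
    have := Real.le_coe_toNNReal a
    push_cast
    linarith [NNReal.coe_pos.mpr hδ]
  · rw [← ENNReal.ofReal_coe_nnreal]
    exact ENNReal.ofReal_le_ofReal (not_lt.mp fun h => hn s h hs)

variable [MetricSpace (ℤ → Am)]

theorem IsStandard.packOuterN_eq_zero (h : IsStandard) {y : ℤ → Am} {ε s : ℝ} (hε : 0 < ε)
    (hs : limsup (rate y) atTop * Real.log 2 < s) : packOuterN TT (fiber y) ε s = 0 := by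
  obtain ⟨k, hk⟩ := exists_two_rpow_neg_lt hε
  obtain ⟨s', h1, h2⟩ := exists_between hs
  have hev := eventually_lt_of_limsup_lt ((lt_div_iff₀ (Real.log_pos one_lt_two)).mpr h1)
    (isBoundedUnder_le_rate y)
  have hP : packPLimN TT (fiber y) ε s = 0 := by
    refine nonpos_iff_eq_zero.mp (ENNReal.le_of_forall_pos_le_add fun δ hδ _ => ?_)
    obtain ⟨N, hN⟩ := eventually_atTop.mp (hev.and ((eventually_gt_atTop 0).and
      (exp_le_mul_inv_two_pow_window y k h2 (NNReal.coe_pos.mpr hδ))))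
    refine iInf_le_of_le N ?_
    rw [zero_add, ← ENNReal.ofReal_coe_nnreal]
    exact h.packPN_le hk fun n hn =>
      (hN n hn).2.2 (mul_log_le_of_rate_lt (hN n hn).2.1 (hN n hn).1)
  refine nonpos_iff_eq_zero.mp (iInf₂_le_of_le (fun _ => fiber y)
    (Set.subset_iUnion (fun _ : ℕ => fiber y) 0) ?_)
  simp [hP]

theorem IsStandard.packEntN_eq (h : IsStandard) (y : ℤ → Am) :
    packEntN TT (fiber y) = ENNReal.ofReal (limsup (rate y) atTop * Real.log 2) := by
  refine le_antisymm (iSup₂_le fun ε hε => ?_) (le_iSup₂_of_le (1 / 2) (by norm_num) ?_)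
  · rw [← critical_eq_ofReal (p := fun s => limsup (rate y) atTop * Real.log 2 < s)
      (fun s hs => hs) fun s hs => hs.not_gt]
    exact iInf_mono fun s => iInf_mono' fun hs => ⟨h.packOuterN_eq_zero hε hs, le_rfl⟩
  · refine (critical_eq_ofReal (fun s => h.packOuterN_eq_zero (by norm_num)) fun s hs => ?_).ge
    have hfr := frequently_lt_of_lt_limsup (isBoundedUnder_ge_rate y).isCoboundedUnder_le
      ((div_lt_iff₀ (Real.log_pos one_lt_two)).mpr hs)
    exact (zero_lt_one.trans_le (h.one_le_packOuterN ((hfr.and_eventually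
      (eventually_gt_atTop 0)).mono fun n hn =>
        inv_two_pow_visited_le (le_mul_log_of_lt_rate hn.2 hn.1)))).ne'

theorem IsStandard.bowenEntN_eq (h : IsStandard) (y : ℤ → Am) :
    bowenEntN TT (fiber y) = ENNReal.ofReal (liminf (rate y) atTop * Real.log 2) := by
  refine critical_eq_ofReal (fun s hs => ?_) fun s hs => ?_
  · obtain ⟨s', h1, h2⟩ := exists_between hs
    have hfr := frequently_lt_of_liminf_lt (isBoundedUnder_le_rate y).isCoboundedUnder_ge
      ((lt_div_iff₀ (Real.log_pos one_lt_two)).mpr h1)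
    refine nonpos_iff_eq_zero.mp (iSup₂_le fun ε hε => iSup_le fun N =>
      ENNReal.le_of_forall_pos_le_add fun δ hδ _ => ?_)
    obtain ⟨k, hk⟩ := exists_two_rpow_neg_lt hε
    obtain ⟨n, hn, hpos, hNn, hexp⟩ := (hfr.and_eventually ((eventually_gt_atTop 0).and
      ((eventually_ge_atTop N).and
        (exp_le_mul_inv_two_pow_window y k h2 (NNReal.coe_pos.mpr hδ))))).exists
    rw [zero_add, ← ENNReal.ofReal_coe_nnreal]
    exact h.bowenMN_le hk hNn (hexp (mul_log_le_of_rate_lt hpos hn))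
  · have hev := eventually_lt_of_lt_liminf ((div_lt_iff₀ (Real.log_pos one_lt_two)).mpr hs)
      (isBoundedUnder_ge_rate y)
    obtain ⟨N, hN⟩ := eventually_atTop.mp (hev.and (eventually_gt_atTop 0))
    refine (zero_lt_one.trans_le ((h.one_le_bowenMN (N := N) fun n hn =>
      inv_two_pow_visited_le (le_mul_log_of_lt_rate (hN n hn).2 (hN n hn).1)).trans ?_)).ne'
    exact le_iSup₂_of_le (1 / 2) (by norm_num) (le_iSup (fun N => bowenMN TT (fiber y) N _ _) N)

end Entropy

/-- Dimensional entropies of fibers of the topological `{T, T⁻¹}` transformation: the metric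
on `A^ℤ` is `d(x, y) = 2^{-n}` with `n = min {|i| : x_i ≠ y_i}` (the metric on the product is
the max metric), and `E_y = A^ℤ × {y}`. Then the packing (resp. Bowen) entropy of `E_y` is
`limsup_n (M(y,n) - m(y,n))/n · log 2` (resp. `liminf`), and `E_y` is regular iff
`lim_n (M(y,n) - m(y,n))/n` exists. -/
theorem tt_transformation_fiber_entropies
    [MetricSpace (ℤ → Am)]
    (hdist : ∀ x y : ℤ → Am, ∀ n : ℕ, (∃ i : ℤ, i.natAbs = n ∧ x i ≠ y i) →
      (∀ i : ℤ, i.natAbs < n → x i = y i) → dist x y = (2 : ℝ) ^ (-(n : ℝ)))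
    (y : ℤ → Am) :
    packEntN TT ((Set.univ : Set (ℤ → Am)) ×ˢ ({y} : Set (ℤ → Am))) =
      ENNReal.ofReal
        ((limsup (fun n : ℕ => ((Mmax y n - mmin y n : ℤ) : ℝ) / (n : ℝ)) atTop) *
          Real.log 2) ∧
    bowenEntN TT ((Set.univ : Set (ℤ → Am)) ×ˢ ({y} : Set (ℤ → Am))) =
      ENNReal.ofReal
        ((liminf (fun n : ℕ => ((Mmax y n - mmin y n : ℤ) : ℝ) / (n : ℝ)) atTop) *
          Real.log 2) ∧
    (bowenEntN TT ((Set.univ : Set (ℤ → Am)) ×ˢ ({y} : Set (ℤ → Am))) =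
        packEntN TT ((Set.univ : Set (ℤ → Am)) ×ˢ ({y} : Set (ℤ → Am))) ↔
      ∃ L : ℝ, Tendsto (fun n : ℕ => ((Mmax y n - mmin y n : ℤ) : ℝ) / (n : ℝ)) atTop
        (nhds L)) := by
  have h : IsStandard := hdist
  refine ⟨h.packEntN_eq y, h.bowenEntN_eq y, ?_⟩
  rw [h.packEntN_eq y, h.bowenEntN_eq y]
  have hlog := Real.log_pos one_lt_two
  rw [ENNReal.ofReal_eq_ofReal_iff (mul_nonneg (liminf_rate_nonneg y) hlog.le)
    (mul_nonneg (limsup_rate_nonneg y) hlog.le), mul_left_inj' hlog.ne']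
  constructor
  · intro he
    exact ⟨_, tendsto_of_liminf_eq_limsup he rfl (isBoundedUnder_le_rate y)
      (isBoundedUnder_ge_rate y)⟩
  · rintro ⟨L, hL⟩
    exact hL.liminf_eq.trans hL.limsup_eq.symm

end TTsystem
end
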